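/- arXiv:2001.08820 — 2 statements merged into one kernel-verified Lean document; each statement's English description precedes it below -/
import Mathlib

section
/- Let a : ℕ → ℝ be a lacunary sequence of positive reals, i.e. there is a constant C > 1 with a(x) > 0 and a(x+1) ≥ C·a(x) for all integers x ≥ 1. Then for Lebesgue almost every α ∈ ℝ, the pair correlation of the fractional parts of α·a(x) is Poissonian: for every real s > 0, lim_{N→∞} (1/N) · #{(m,n) : 1 ≤ m, n ≤ N, m ≠ n, ‖α·a(m) − α·a(n)‖ ≤ s/N} = 2s, where ‖t‖ denotes the distance from the real number t to the nearest integer. -/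
open MeasureTheory Filter

/-- The set of `α` for which `α * y` lies within `δ` of an integer. -/
def nearInt (y δ : ℝ) : Set ℝ := {α | |α * y - round (α * y)| ≤ δ}

theorem mem_nearInt_iff {y δ α : ℝ} : α ∈ nearInt y δ ↔ ∃ k : ℤ, |α * y - k| ≤ δ :=
  ⟨fun h => ⟨_, h⟩, fun ⟨k, hk⟩ => (round_le _ k).trans hk⟩

theorem measurableSet_nearInt (y δ : ℝ) : MeasurableSet (nearInt y δ) := by
  have : nearInt y δ = ⋃ k : ℤ, {α | |α * y - k| ≤ δ} := by
    ext α; simp [mem_nearInt_iff]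
  rw [this]
  exact MeasurableSet.iUnion fun k =>
    (isClosed_le (by fun_prop) continuous_const).measurableSet

theorem nearInt_inter_subset (y y' δ δ' : ℝ) :
    nearInt (y + y') δ ∩ nearInt y δ' ⊆ nearInt y' (δ + δ') := by
  rintro α ⟨h, h'⟩
  obtain ⟨k, hk⟩ := mem_nearInt_iff.1 h
  obtain ⟨l, hl⟩ := mem_nearInt_iff.1 h'
  refine mem_nearInt_iff.2 ⟨k - l, ?_⟩
  push_cast
  rw [abs_le] at *
  constructor <;> linarith [hk.1, hk.2, hl.1, hl.2]

theorem exists_cover_nearInt {y δ u v : ℝ} (hy : 0 < y) (hδ : δ ≤ 1) (huv : u ≤ v) :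
    ∃ K : Finset ℤ, (K.card : ℝ) ≤ (v - u) * y + 3 ∧
      Set.Icc u v ∩ nearInt y δ ⊆ ⋃ k ∈ K, Set.Icc ((k - δ) / y) ((k + δ) / y) := by
  refine ⟨Finset.Icc ⌈u * y - δ⌉ ⌊v * y + δ⌋, ?_, ?_⟩
  · rw [Int.card_Icc]
    have h1 := Int.floor_le (v * y + δ)
    have h2 := Int.le_ceil (u * y - δ)
    have h3 : 0 ≤ (v - u) * y := mul_nonneg (by linarith) hy.le
    have h4 : (((⌊v * y + δ⌋ + 1 - ⌈u * y - δ⌉).toNat : ℤ) : ℝ) ≤ (v - u) * y + 3 := by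
      rw [Int.toNat_eq_max]
      push_cast
      exact max_le (by linarith) (by linarith)
    exact_mod_cast h4
  · rintro α ⟨⟨h1, h2⟩, h⟩
    obtain ⟨k, hk⟩ := mem_nearInt_iff.1 h
    rw [abs_le] at hk
    have h1' := mul_le_mul_of_nonneg_right h1 hy.le
    have h2' := mul_le_mul_of_nonneg_right h2 hy.le
    simp only [Set.mem_iUnion, Finset.mem_Icc, Set.mem_Icc, div_le_iff₀ hy, le_div_iff₀ hy]
    refine ⟨k, ⟨Int.ceil_le.2 (by linarith), Int.le_floor.2 (by linarith)⟩, ?_, ?_⟩ <;>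
    linarith [hk.1, hk.2]

theorem measureReal_nearInt_le {y δ u v : ℝ} (hy : 0 < y) (hδ0 : 0 ≤ δ) (hδ : δ ≤ 1)
    (huv : u ≤ v) :
    volume.real (Set.Icc u v ∩ nearInt y δ) ≤ 2 * δ * (v - u + 3 / y) := by
  obtain ⟨K, hK, hsub⟩ := exists_cover_nearInt hy hδ huv
  have h0 : 0 ≤ 2 * δ / y := by positivity
  calc volume.real (Set.Icc u v ∩ nearInt y δ)
      ≤ volume.real (⋃ k ∈ K, Set.Icc (((k : ℝ) - δ) / y) ((k + δ) / y)) :=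
        measureReal_mono hsub ((measure_biUnion_lt_top K.finite_toSet
          fun k _ => measure_Icc_lt_top).ne)
    _ ≤ ∑ k ∈ K, volume.real (Set.Icc (((k : ℝ) - δ) / y) ((k + δ) / y)) :=
        measureReal_biUnion_finset_le _ _
    _ = ∑ k ∈ K, 2 * δ / y := by
        refine Finset.sum_congr rfl fun k _ => ?_
        have : ((k : ℝ) + δ) / y - (k - δ) / y = 2 * δ / y := by ring
        rw [Real.volume_real_Icc, this, max_eq_left h0]
    _ = K.card * (2 * δ / y) := by simp
    _ ≤ ((v - u) * y + 3) * (2 * δ / y) := by gcongr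
    _ = _ := by field_simp

theorem measureReal_nearInt_inter_le {x y δ δ' u v : ℝ} (hx : 0 < x) (hy : 0 < y) (hδ0 : 0 ≤ δ)
    (hδ : δ ≤ 1) (hδ0' : 0 ≤ δ') (hδ' : δ' ≤ 1) (huv : u ≤ v) :
    volume.real (Set.Icc u v ∩ (nearInt x δ ∩ nearInt y δ')) ≤
      ((v - u) * x + 3) * (2 * δ' * (2 * δ / x + 3 / y)) := by
  obtain ⟨K, hK, hsub⟩ := exists_cover_nearInt hx hδ huv
  have h0 : 0 ≤ 2 * δ / x := by positivity
  have hsub' : Set.Icc u v ∩ (nearInt x δ ∩ nearInt y δ') ⊆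
      ⋃ k ∈ K, Set.Icc (((k : ℝ) - δ) / x) ((k + δ) / x) ∩ nearInt y δ' := by
    rintro α ⟨h1, h2, h3⟩
    have := hsub ⟨h1, h2⟩
    simp only [Set.mem_iUnion] at this ⊢
    obtain ⟨k, hk, h⟩ := this
    exact ⟨k, hk, h, h3⟩
  calc volume.real (Set.Icc u v ∩ (nearInt x δ ∩ nearInt y δ'))
      ≤ volume.real (⋃ k ∈ K, Set.Icc (((k : ℝ) - δ) / x) ((k + δ) / x) ∩ nearInt y δ') :=
        measureReal_mono hsub' ((measure_biUnion_lt_top K.finite_toSet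
          fun k _ => (measure_mono Set.inter_subset_left).trans_lt measure_Icc_lt_top).ne)
    _ ≤ ∑ k ∈ K, volume.real (Set.Icc (((k : ℝ) - δ) / x) ((k + δ) / x) ∩ nearInt y δ') :=
        measureReal_biUnion_finset_le _ _
    _ ≤ ∑ k ∈ K, 2 * δ' * (2 * δ / x + 3 / y) := by
        refine Finset.sum_le_sum fun k _ => ?_
        have : ((k : ℝ) + δ) / x - (k - δ) / x = 2 * δ / x := by ring
        have h := measureReal_nearInt_le (u := (k - δ) / x) (v := (k + δ) / x) hy hδ0' hδ'
          (by linarith)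
        rwa [this] at h
    _ = K.card * (2 * δ' * (2 * δ / x + 3 / y)) := by simp
    _ ≤ _ := by gcongr

theorem le_measureReal_nearInt {y δ u v : ℝ} (hy : 0 < y) (hδ0 : 0 ≤ δ) (hδ : δ < 1 / 2) :
    2 * δ * (v - u - 3 / y) ≤ volume.real (Set.Icc u v ∩ nearInt y δ) := by
  have h0 : 0 ≤ 2 * δ / y := by positivity
  set K := Finset.Icc ⌈u * y + δ⌉ ⌊v * y - δ⌋ with hKdef
  have hK : (v - u) * y - 3 ≤ K.card := by
    rw [hKdef, Int.card_Icc]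
    have h1 := Int.lt_floor_add_one (v * y - δ)
    have h2 := Int.ceil_lt_add_one (u * y + δ)
    have h4 : (v - u) * y - 3 ≤ (((⌊v * y - δ⌋ + 1 - ⌈u * y + δ⌉).toNat : ℤ) : ℝ) := by
      rw [Int.toNat_eq_max]
      push_cast
      exact le_max_of_le_left (by linarith)
    exact_mod_cast h4
  have hsub : (⋃ k ∈ K, Set.Icc (((k : ℝ) - δ) / y) ((k + δ) / y)) ⊆
      Set.Icc u v ∩ nearInt y δ := by
    intro α h
    simp only [Set.mem_iUnion, Set.mem_Icc, hKdef, Finset.mem_Icc, Int.ceil_le, Int.le_floor,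
      div_le_iff₀ hy, le_div_iff₀ hy] at h
    obtain ⟨k, ⟨h1, h2⟩, h3, h4⟩ := h
    refine ⟨⟨le_of_mul_le_mul_right (by linarith) hy, le_of_mul_le_mul_right (by linarith) hy⟩,
      mem_nearInt_iff.2 ⟨k, abs_le.2 ⟨by linarith, by linarith⟩⟩⟩
  have hdisj : (K : Set ℤ).PairwiseDisjoint
      fun k : ℤ => Set.Icc (((k : ℝ) - δ) / y) ((k + δ) / y) := by
    intro k _ l _ hkl
    refine Set.disjoint_left.2 fun α h1 h2 => hkl ?_
    simp only [Set.mem_Icc, div_le_iff₀ hy, le_div_iff₀ hy] at h1 h2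
    have h3 : (k : ℝ) < l + 1 := by linarith
    have h4 : (l : ℝ) < k + 1 := by linarith
    norm_cast at h3 h4
    omega
  calc 2 * δ * (v - u - 3 / y) = ((v - u) * y - 3) * (2 * δ / y) := by field_simp
    _ ≤ K.card * (2 * δ / y) := by gcongr
    _ = ∑ k ∈ K, 2 * δ / y := by simp
    _ = ∑ k ∈ K, volume.real (Set.Icc (((k : ℝ) - δ) / y) ((k + δ) / y)) := by
        refine Finset.sum_congr rfl fun k _ => ?_
        have : ((k : ℝ) + δ) / y - (k - δ) / y = 2 * δ / y := by ring
        rw [Real.volume_real_Icc, this, max_eq_left h0]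
    _ = volume.real (⋃ k ∈ K, Set.Icc (((k : ℝ) - δ) / y) ((k + δ) / y)) :=
        (measureReal_biUnion_finset hdisj (fun k _ => measurableSet_Icc)
          (fun k _ => measure_Icc_lt_top.ne)).symm
    _ ≤ _ := measureReal_mono hsub
        ((measure_mono Set.inter_subset_left).trans_lt measure_Icc_lt_top).ne

/-- Second moment bound for a triangular array of centred indicator functions that are nearly
uncorrelated as soon as their first indices differ by at least `L`. -/
theorem integral_sq_sum_indicator_le {Ω : Type*} [MeasurableSpace Ω] (μ : Measure Ω)
    [IsFiniteMeasure μ] (E : ℕ → ℕ → Set Ω) (hE : ∀ m n, MeasurableSet (E m n)) (L N : ℕ)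
    (δ η : ℝ) (hδ0 : 0 ≤ δ) (hδ : δ ≤ 1 / 4) (hη : 0 ≤ η) (hL : 1 ≤ L)
    (hlow : ∀ m n, L < m → 1 ≤ n → n < m → 2 * δ * μ.real Set.univ - η ≤ μ.real (E m n))
    (hup : ∀ m n, L < m → 1 ≤ n → n < m → μ.real (E m n) ≤ 2 * δ * μ.real Set.univ + η)
    (hfar : ∀ m n m' n', L < m' → m' + L ≤ m → 1 ≤ n → n < m → 1 ≤ n' → n' < m' →
      μ.real (E m n ∩ E m' n') ≤ 4 * δ ^ 2 * μ.real Set.univ + η)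
    (hrow : ∀ m n n', L < n → n + L ≤ m → 1 ≤ n' → n' < n →
      μ.real (E m n ∩ E m n') ≤ 8 * δ ^ 2 * μ.real Set.univ + η) :
    ∫ ω, (∑ m ∈ Finset.Ioc L N, ∑ n ∈ Finset.Ico 1 m,
        ((E m n).indicator (fun _ => (1 : ℝ)) ω - 2 * δ)) ^ 2 ∂μ ≤
      N ^ 4 * (2 * η) + 2 * L * N * (N ^ 2 * (4 * δ ^ 2 * μ.real Set.univ + 2 * η) +
        4 * L * N * (2 * δ * μ.real Set.univ)) := by
  set l := μ.real Set.univ with hl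
  have hl0 : 0 ≤ l := measureReal_nonneg
  set f : ℕ → ℕ → Ω → ℝ := fun m n ω => (E m n).indicator (fun _ => (1 : ℝ)) ω - 2 * δ with hf
  have hInd : ∀ s : Set Ω, MeasurableSet s →
      Integrable (fun ω => s.indicator (fun _ => (1 : ℝ)) ω) μ := fun s hs =>
    (integrable_const (1 : ℝ)).indicator hs
  have hprod : ∀ m n m' n', (fun ω => f m n ω * f m' n' ω) = fun ω =>
      (E m n ∩ E m' n').indicator (fun _ => (1 : ℝ)) ω
        - 2 * δ * (E m n).indicator (fun _ => (1 : ℝ)) ω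
        - 2 * δ * (E m' n').indicator (fun _ => (1 : ℝ)) ω + 4 * δ ^ 2 := by
    intro m n m' n'
    funext ω
    by_cases h : ω ∈ E m n <;> by_cases h' : ω ∈ E m' n' <;> simp [hf, h, h'] <;> ring
  have hmulint : ∀ m n m' n', Integrable (fun ω => f m n ω * f m' n' ω) μ := by
    intro m n m' n'
    rw [hprod]
    exact (((hInd _ ((hE m n).inter (hE m' n'))).sub ((hInd _ (hE m n)).const_mul _)).sub
      ((hInd _ (hE m' n')).const_mul _)).add (integrable_const _)
  have hval : ∀ m n m' n', ∫ ω, f m n ω * f m' n' ω ∂μ =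
      μ.real (E m n ∩ E m' n') - 2 * δ * μ.real (E m n) - 2 * δ * μ.real (E m' n')
        + 4 * δ ^ 2 * l := by
    intro m n m' n'
    have i1 := hInd _ ((hE m n).inter (hE m' n'))
    have i2 := (hInd _ (hE m n)).const_mul (2 * δ)
    have i3 := (hInd _ (hE m' n')).const_mul (2 * δ)
    have e : ∀ s : Set Ω, MeasurableSet s →
        ∫ ω, s.indicator (fun _ => (1 : ℝ)) ω ∂μ = μ.real s := fun s hs => by
      rw [integral_indicator_const _ hs]; simp
    have i12 : Integrable (fun ω => (E m n ∩ E m' n').indicator (fun _ => (1 : ℝ)) ω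
        - 2 * δ * (E m n).indicator (fun _ => (1 : ℝ)) ω) μ := i1.sub i2
    have i123 : Integrable (fun ω => (E m n ∩ E m' n').indicator (fun _ => (1 : ℝ)) ω
        - 2 * δ * (E m n).indicator (fun _ => (1 : ℝ)) ω
        - 2 * δ * (E m' n').indicator (fun _ => (1 : ℝ)) ω) μ := i12.sub i3
    rw [hprod, integral_add i123 (integrable_const _), integral_sub i12 i3, integral_sub i1 i2,
      integral_const_mul, integral_const_mul, e _ ((hE m n).inter (hE m' n')),
      e _ (hE m n), e _ (hE m' n'), integral_const, smul_eq_mul, ← hl]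
    ring
  set F : ℕ → Ω → ℝ := fun m ω => ∑ n ∈ Finset.Ico 1 m, f m n ω with hF
  have hFmul : ∀ m m', (fun ω => F m ω * F m' ω) = fun ω =>
      ∑ n ∈ Finset.Ico 1 m, ∑ n' ∈ Finset.Ico 1 m', f m n ω * f m' n' ω := by
    intro m m'
    funext ω
    simp only [hF, Finset.sum_mul_sum]
  have hFint : ∀ m m', Integrable (fun ω => F m ω * F m' ω) μ := by
    intro m m'
    rw [hFmul]
    exact integrable_finsetSum _ fun n _ => integrable_finsetSum _ fun n' _ => hmulint _ _ _ _
  have hFval : ∀ m m', ∫ ω, F m ω * F m' ω ∂μ =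
      ∑ n ∈ Finset.Ico 1 m, ∑ n' ∈ Finset.Ico 1 m', ∫ ω, f m n ω * f m' n' ω ∂μ := by
    intro m m'
    rw [hFmul, integral_finsetSum _ fun n _ => integrable_finsetSum _ fun n' _ => hmulint _ _ _ _]
    exact Finset.sum_congr rfl fun n _ => integral_finsetSum _ fun n' _ => hmulint _ _ _ _
  have hFfar : ∀ m m', L < m' → m' + L ≤ m → m ≤ N → ∫ ω, F m ω * F m' ω ∂μ ≤
      N ^ 2 * (2 * η) := by
    intro m m' h1 h2 h3
    rw [hFval]
    calc ∑ n ∈ Finset.Ico 1 m, ∑ n' ∈ Finset.Ico 1 m', ∫ ω, f m n ω * f m' n' ω ∂μ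
        ≤ ∑ n ∈ Finset.Ico 1 m, ∑ n' ∈ Finset.Ico 1 m', 2 * η := by
          refine Finset.sum_le_sum fun n hn => Finset.sum_le_sum fun n' hn' => ?_
          rw [Finset.mem_Ico] at hn hn'
          rw [hval]
          have a1 := hfar m n m' n' h1 h2 hn.1 hn.2 hn'.1 hn'.2
          have a2 := hlow m n (by omega) hn.1 hn.2
          have a3 := hlow m' n' (by omega) hn'.1 hn'.2
          nlinarith [mul_le_mul_of_nonneg_left a2 hδ0, mul_le_mul_of_nonneg_left a3 hδ0]
      _ = ((m - 1 : ℕ) : ℝ) * (m' - 1 : ℕ) * (2 * η) := by simp [mul_assoc]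
      _ ≤ (N : ℝ) * N * (2 * η) := by
          gcongr <;> omega
      _ = _ := by ring
  set V : ℝ := N ^ 2 * (4 * δ ^ 2 * l + 2 * η) + 4 * L * N * (2 * δ * l) with hV
  have hV0 : 0 ≤ V := by positivity
  have hFrow : ∀ m, L < m → m ≤ N → ∫ ω, F m ω * F m ω ∂μ ≤ V := by
    intro m h1 h3
    rw [hFval]
    have hmN : ((m - 1 : ℕ) : ℝ) ≤ N := by exact_mod_cast (by omega : m - 1 ≤ N)
    have hL' : (1 : ℝ) ≤ L := by exact_mod_cast hL
    have key : ∀ n ∈ Finset.Ico 1 m, ∀ n' ∈ Finset.Ico 1 m,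
        ∫ ω, f m n ω * f m n' ω ∂μ ≤ (4 * δ ^ 2 * l + 2 * η) +
          ((if n = n' then 1 else 0) + (if n ≤ L then 1 else 0) + (if m < n + L then 1 else 0)
            + (if m < n' + L then 1 else 0)) * (2 * δ * l) := by
      intro n hn n' hn'
      rw [Finset.mem_Ico] at hn hn'
      have a2 := hlow m n (by omega) hn.1 hn.2
      have a3 := hlow m n' (by omega) hn'.1 hn'.2
      have a2' := mul_le_mul_of_nonneg_left a2 hδ0
      have a3' := mul_le_mul_of_nonneg_left a3 hδ0
      have b0 : 0 ≤ 2 * δ * l := by positivity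
      have b1 : 0 ≤ δ ^ 2 * l := by positivity
      have b2 : δ * η ≤ 1 / 4 * η := by gcongr
      rw [hval]
      by_cases hbad : n = n' ∨ n ≤ L ∨ m < n + L ∨ m < n' + L
      · have a1 : μ.real (E m n ∩ E m n') ≤ 2 * δ * l + η :=
          (measureReal_mono Set.inter_subset_left).trans (hup m n h1 hn.1 hn.2)
        have hc : (1 : ℝ) ≤ ((if n = n' then 1 else 0) + (if n ≤ L then 1 else 0)
            + (if m < n + L then 1 else 0) + (if m < n' + L then 1 else 0)) := by
          rcases hbad with h | h | h | h <;> simp only [h, if_true] <;> split_ifs <;> norm_num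
        have := mul_le_mul_of_nonneg_right hc b0
        nlinarith
      · push Not at hbad
        have a1 : μ.real (E m n ∩ E m n') ≤ 8 * δ ^ 2 * l + η := by
          rcases lt_or_gt_of_ne hbad.1 with h | h
          · rw [Set.inter_comm]
            exact hrow m n' n (by omega) (by omega) hn.1 h
          · exact hrow m n n' (by omega) (by omega) hn'.1 h
        have hc : (0 : ℝ) ≤ ((if n = n' then 1 else 0) + (if n ≤ L then 1 else 0)
            + (if m < n + L then 1 else 0) + (if m < n' + L then 1 else 0)) := by
          split_ifs <;> norm_num
        have := mul_nonneg hc b0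
        nlinarith
    have c1 : ∑ n ∈ Finset.Ico 1 m, (if n ≤ L then (1 : ℝ) else 0) ≤ L := by
      rw [Finset.sum_boole]
      have : (Finset.filter (fun n => n ≤ L) (Finset.Ico 1 m)).card ≤ (Finset.Icc 1 L).card :=
        Finset.card_le_card fun n hn => by simp at hn ⊢; omega
      simpa using this
    have c2 : ∑ n ∈ Finset.Ico 1 m, (if m < n + L then (1 : ℝ) else 0) ≤ L := by
      rw [Finset.sum_boole]
      have : (Finset.filter (fun n => m < n + L) (Finset.Ico 1 m)).card ≤
          (Finset.Ioo (m - L) m).card :=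
        Finset.card_le_card fun n hn => by simp at hn ⊢; omega
      rw [Nat.card_Ioo] at this
      exact_mod_cast this.trans (by omega)
    have c3 : ∀ n ∈ Finset.Ico 1 m, ∑ n' ∈ Finset.Ico 1 m, (if n = n' then (1 : ℝ) else 0) ≤ 1 := by
      intro n hn
      rw [Finset.sum_ite_eq]
      split_ifs
      all_goals norm_num
    have hcard : (Finset.Ico 1 m).card = m - 1 := by simp
    calc ∑ n ∈ Finset.Ico 1 m, ∑ n' ∈ Finset.Ico 1 m, ∫ ω, f m n ω * f m n' ω ∂μ
        ≤ ∑ n ∈ Finset.Ico 1 m, ∑ n' ∈ Finset.Ico 1 m, ((4 * δ ^ 2 * l + 2 * η) +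
          ((if n = n' then 1 else 0) + (if n ≤ L then 1 else 0) + (if m < n + L then 1 else 0)
            + (if m < n' + L then 1 else 0)) * (2 * δ * l)) :=
          Finset.sum_le_sum fun n hn => Finset.sum_le_sum fun n' hn' => key n hn n' hn'
      _ = ((m - 1 : ℕ) : ℝ) * (m - 1 : ℕ) * (4 * δ ^ 2 * l + 2 * η) +
          ((∑ n ∈ Finset.Ico 1 m, ∑ n' ∈ Finset.Ico 1 m, (if n = n' then (1 : ℝ) else 0))
            + (m - 1 : ℕ) * (∑ n ∈ Finset.Ico 1 m, (if n ≤ L then (1 : ℝ) else 0))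
            + (m - 1 : ℕ) * (∑ n ∈ Finset.Ico 1 m, (if m < n + L then (1 : ℝ) else 0))
            + (m - 1 : ℕ) * (∑ n ∈ Finset.Ico 1 m, (if m < n + L then (1 : ℝ) else 0)))
              * (2 * δ * l) := by
          simp only [Finset.sum_add_distrib, ← Finset.sum_mul, Finset.sum_const, hcard,
            nsmul_eq_mul, ← Finset.mul_sum]
          ring
      _ ≤ (N : ℝ) * N * (4 * δ ^ 2 * l + 2 * η) +
          ((N * L + N * L + N * L + N * L : ℝ)) * (2 * δ * l) := by
          gcongr
          calc _ ≤ ∑ n ∈ Finset.Ico 1 m, (1 : ℝ) := Finset.sum_le_sum c3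
            _ = (m - 1 : ℕ) := by simp
            _ ≤ N * 1 := by simpa using hmN
            _ ≤ N * L := by gcongr
      _ = V := by rw [hV]; ring
  have hFnear : ∀ m m', L < m → m ≤ N → L < m' → m' ≤ N → ∫ ω, F m ω * F m' ω ∂μ ≤ V := by
    intro m m' h1 h2 h3 h4
    calc ∫ ω, F m ω * F m' ω ∂μ ≤ ∫ ω, (1 / 2 * (F m ω * F m ω) + 1 / 2 * (F m' ω * F m' ω)) ∂μ :=
          integral_mono (hFint _ _) (((hFint m m).const_mul _).add ((hFint m' m').const_mul _))
            fun ω => by nlinarith [sq_nonneg (F m ω - F m' ω)]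
      _ = 1 / 2 * ∫ ω, F m ω * F m ω ∂μ + 1 / 2 * ∫ ω, F m' ω * F m' ω ∂μ := by
          rw [integral_add ((hFint m m).const_mul _) ((hFint m' m').const_mul _),
            integral_const_mul, integral_const_mul]
      _ ≤ V := by linarith [hFrow m h1 h2, hFrow m' h3 h4]
  have hsq : (fun ω => (∑ m ∈ Finset.Ioc L N, ∑ n ∈ Finset.Ico 1 m,
        ((E m n).indicator (fun _ => (1 : ℝ)) ω - 2 * δ)) ^ 2) =
      fun ω => ∑ m ∈ Finset.Ioc L N, ∑ m' ∈ Finset.Ioc L N, F m ω * F m' ω := by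
    funext ω
    rw [sq, Finset.sum_mul_sum]
  rw [hsq, integral_finsetSum _ fun m _ => integrable_finsetSum _ fun m' _ => hFint _ _]
  have hcardN : ((Finset.Ioc L N).card : ℝ) ≤ N := by
    rw [Nat.card_Ioc]; exact_mod_cast Nat.sub_le _ _
  have hcount : ∀ m ∈ Finset.Ioc L N,
      ∑ m' ∈ Finset.Ioc L N, (if m < m' + L ∧ m' < m + L then (1 : ℝ) else 0) ≤ 2 * L := by
    intro m hm
    rw [Finset.sum_boole]
    have : (Finset.filter (fun m' => m < m' + L ∧ m' < m + L) (Finset.Ioc L N)).card ≤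
        (Finset.Ioo (m - L) (m + L)).card :=
      Finset.card_le_card fun n hn => by simp at hn hm ⊢; omega
    rw [Nat.card_Ioo] at this
    exact_mod_cast this.trans (by omega)
  calc ∑ m ∈ Finset.Ioc L N, ∫ ω, ∑ m' ∈ Finset.Ioc L N, F m ω * F m' ω ∂μ
      = ∑ m ∈ Finset.Ioc L N, ∑ m' ∈ Finset.Ioc L N, ∫ ω, F m ω * F m' ω ∂μ :=
        Finset.sum_congr rfl fun m _ => integral_finsetSum _ fun m' _ => hFint _ _
    _ ≤ ∑ m ∈ Finset.Ioc L N, ∑ m' ∈ Finset.Ioc L N, (N ^ 2 * (2 * η) +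
          (if m < m' + L ∧ m' < m + L then 1 else 0) * V) := by
        refine Finset.sum_le_sum fun m hm => Finset.sum_le_sum fun m' hm' => ?_
        rw [Finset.mem_Ioc] at hm hm'
        split_ifs with h
        · have := hFnear m m' hm.1 hm.2 hm'.1 hm'.2
          have : 0 ≤ (N : ℝ) ^ 2 * (2 * η) := by positivity
          linarith
        · rw [zero_mul, add_zero]
          rcases not_and_or.1 h with h | h
          · exact hFfar m m' hm'.1 (by omega) hm.2
          · have := hFfar m' m hm.1 (by omega) hm'.2
            simpa only [mul_comm] using this
    _ ≤ ∑ m ∈ Finset.Ioc L N, (N * (N ^ 2 * (2 * η)) + 2 * L * V) := by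
        refine Finset.sum_le_sum fun m hm => ?_
        rw [Finset.sum_add_distrib, Finset.sum_const, nsmul_eq_mul, ← Finset.sum_mul]
        exact add_le_add (mul_le_mul_of_nonneg_right hcardN (by positivity))
          (mul_le_mul_of_nonneg_right (hcount m hm) hV0)
    _ ≤ N * (N * (N ^ 2 * (2 * η)) + 2 * L * V) := by
        rw [Finset.sum_const, nsmul_eq_mul]
        gcongr
    _ = _ := by ring

theorem pow_mul_le_of_lacunary {a : ℕ → ℝ} {C : ℝ} (hC : 1 < C)
    (hlac : ∀ x : ℕ, 1 ≤ x → C * a x ≤ a (x + 1)) {n : ℕ} (hn : 1 ≤ n) (j : ℕ) :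
    C ^ j * a n ≤ a (n + j) := by
  induction j with
  | zero => simp
  | succ j ih =>
    calc C ^ (j + 1) * a n = C * (C ^ j * a n) := by ring
      _ ≤ C * a (n + j) := by gcongr
      _ ≤ a (n + (j + 1)) := hlac _ (by omega)

theorem exists_gap_of_lacunary {a : ℕ → ℝ} {C : ℝ} (hC : 1 < C)
    (hpos : ∀ x : ℕ, 1 ≤ x → 0 < a x) (hlac : ∀ x : ℕ, 1 ≤ x → C * a x ≤ a (x + 1)) :
    ∃ w : ℝ, 0 < w ∧
      (∀ k m n, k < m → 1 ≤ n → n < m → w * C ^ k ≤ a m - a n) ∧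
      (∀ k m n m' n', 1 ≤ m' → m' + k ≤ m → 1 ≤ n → n < m → 1 ≤ n' → n' < m' →
        w * C ^ k * (a m' - a n') ≤ a m - a n) := by
  have hC0 : 0 < C := by linarith
  have hc : 0 < 1 - C⁻¹ := by linarith [inv_lt_one_of_one_lt₀ hC]
  have hgrow : ∀ n j m, 1 ≤ n → n + j ≤ m → C ^ j * a n ≤ a m := by
    intro n j m hn hm
    obtain ⟨i, rfl⟩ := Nat.exists_eq_add_of_le hm
    calc C ^ j * a n ≤ C ^ (j + i) * a n :=
          mul_le_mul_of_nonneg_right (pow_le_pow_right₀ hC.le (by omega)) (hpos n hn).le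
      _ ≤ a (n + (j + i)) := pow_mul_le_of_lacunary hC hlac hn _
      _ = a (n + j + i) := by rw [add_assoc]
  have hgap : ∀ m n, 1 ≤ n → n < m → (1 - C⁻¹) * a m ≤ a m - a n := by
    intro m n hn hm
    have h := hgrow n 1 m hn hm
    rw [pow_one] at h
    have : a n ≤ C⁻¹ * a m := by
      rw [inv_mul_eq_div, le_div_iff₀ hC0]; linarith
    linarith
  refine ⟨(1 - C⁻¹) * min (a 1) 1, mul_pos hc (lt_min (hpos 1 le_rfl) one_pos), ?_, ?_⟩
  · intro k m n hk hn hm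
    refine le_trans ?_ (hgap m n hn hm)
    rw [mul_assoc]
    refine mul_le_mul_of_nonneg_left ?_ hc.le
    calc min (a 1) 1 * C ^ k ≤ a 1 * C ^ k := by gcongr; exact min_le_left _ _
      _ = C ^ k * a 1 := mul_comm _ _
      _ ≤ a m := hgrow 1 k m le_rfl (by omega)
  · intro k m n m' n' hm' hk hn hm hn' hnm'
    refine le_trans ?_ (hgap m n hn hm)
    rw [mul_assoc, mul_assoc]
    refine mul_le_mul_of_nonneg_left ?_ hc.le
    have h0 : 0 ≤ a m' - a n' :=
      le_trans (mul_nonneg hc.le (hpos m' hm').le) (hgap m' n' hn' hnm')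
    calc min (a 1) 1 * (C ^ k * (a m' - a n')) ≤ 1 * (C ^ k * (a m' - a n')) := by
          gcongr; exact min_le_right _ _
      _ ≤ C ^ k * a m' := by
          rw [one_mul]; gcongr; linarith [hpos n' hn']
      _ ≤ a m := hgrow m' k m hm' hk

theorem measureReal_nearInt_inter_le_of_gap {x y δ δ' u v B : ℝ} (hB : 1 ≤ B) (hx : B ≤ x)
    (hxy : B * x ≤ y) (hδ0 : 0 ≤ δ) (hδ : δ ≤ 1) (hδ0' : 0 ≤ δ') (hδ' : δ' ≤ 1) (huv : u ≤ v) :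
    volume.real (Set.Icc u v ∩ (nearInt x δ ∩ nearInt y δ')) ≤
      4 * δ * δ' * (v - u) + (6 * (v - u) + 30) / B := by
  have hB0 : 0 < B := by linarith
  have hx0 : 0 < x := by linarith
  have hy0 : 0 < y := lt_of_lt_of_le (mul_pos hB0 hx0) hxy
  have hBy : B ≤ y := hx.trans ((le_mul_of_one_le_left hx0.le hB).trans hxy)
  have hl : 0 ≤ v - u := by linarith
  refine (measureReal_nearInt_inter_le hx0 hy0 hδ0 hδ hδ0' hδ' huv).trans ?_
  have h1 : x / y ≤ 1 / B := by
    rw [div_le_div_iff₀ hy0 hB0]; linarith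
  have h2 : 1 / x ≤ 1 / B := one_div_le_one_div_of_le hB0 hx
  have h3 : 1 / y ≤ 1 / B := one_div_le_one_div_of_le hB0 hBy
  have h4 : δ * δ' ≤ 1 := mul_le_one₀ hδ hδ0' hδ'
  calc ((v - u) * x + 3) * (2 * δ' * (2 * δ / x + 3 / y))
      = 4 * δ * δ' * (v - u) + (6 * (v - u) * (δ' * (x / y)) + 12 * (δ * δ' * (1 / x))
          + 18 * (δ' * (1 / y))) := by field_simp; ring
    _ ≤ 4 * δ * δ' * (v - u) + (6 * (v - u) * (1 * (1 / B)) + 12 * (1 * (1 / B))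
          + 18 * (1 * (1 / B))) := by gcongr
    _ = _ := by ring

/-- The number of pairs `n < m ≤ N` for which `α * (a m - a n)` is within `δ` of an integer. -/
noncomputable def pairCount (a : ℕ → ℝ) (α : ℝ) (N : ℕ) (δ : ℝ) : ℝ :=
  ∑ m ∈ Finset.Ioc 0 N, ∑ n ∈ Finset.Ico 1 m,
    (nearInt (a m - a n) δ).indicator (fun _ => (1 : ℝ)) α

theorem pairCount_mono (a : ℕ → ℝ) (α : ℝ) {N N' : ℕ} {δ δ' : ℝ} (hN : N ≤ N') (hδ : δ ≤ δ') :
    pairCount a α N δ ≤ pairCount a α N' δ' := by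
  have h0 : ∀ (s : Set ℝ), 0 ≤ s.indicator (fun _ => (1 : ℝ)) α := fun s =>
    Set.indicator_nonneg (fun _ _ => zero_le_one) _
  calc pairCount a α N δ ≤ pairCount a α N δ' :=
        Finset.sum_le_sum fun m _ => Finset.sum_le_sum fun n _ =>
          Set.indicator_le_indicator_of_subset (fun β hβ => le_trans hβ hδ)
            (fun _ => zero_le_one) α
    _ ≤ _ := Finset.sum_le_sum_of_subset_of_nonneg (Finset.Ioc_subset_Ioc_right hN)
        fun m _ _ => Finset.sum_nonneg fun n _ => h0 _

theorem pairCount_nonneg (a : ℕ → ℝ) (α : ℝ) (N : ℕ) (δ : ℝ) : 0 ≤ pairCount a α N δ :=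
  Finset.sum_nonneg fun _ _ => Finset.sum_nonneg fun _ _ =>
    Set.indicator_nonneg (fun _ _ => zero_le_one) _

theorem pairCount_le (a : ℕ → ℝ) (α : ℝ) (N : ℕ) (δ : ℝ) : pairCount a α N δ ≤ (N : ℝ) ^ 2 := by
  calc pairCount a α N δ ≤ ∑ m ∈ Finset.Ioc 0 N, ∑ n ∈ Finset.Ico 1 m, (1 : ℝ) :=
        Finset.sum_le_sum fun m _ => Finset.sum_le_sum fun n _ =>
          Set.indicator_le_self' (fun _ _ => zero_le_one) α
    _ ≤ ∑ m ∈ Finset.Ioc 0 N, (N : ℝ) := Finset.sum_le_sum fun m hm => by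
        rw [Finset.mem_Ioc] at hm
        simp only [Finset.sum_const, Nat.card_Ico, nsmul_eq_mul, mul_one]
        exact_mod_cast (by omega : m - 1 ≤ N)
    _ = _ := by simp [sq]

theorem mem_nearInt_sub_comm {x y δ α : ℝ} : α ∈ nearInt (x - y) δ ↔ α ∈ nearInt (y - x) δ := by
  have : ∀ x y : ℝ, α ∈ nearInt (x - y) δ → α ∈ nearInt (y - x) δ := by
    intro x y h
    obtain ⟨k, hk⟩ := mem_nearInt_iff.1 h
    refine mem_nearInt_iff.2 ⟨-k, ?_⟩
    rw [← abs_neg]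
    convert hk using 2
    push_cast; ring
  exact ⟨this x y, this y x⟩

theorem ncard_eq_two_mul_pairCount (a : ℕ → ℝ) (α : ℝ) (N : ℕ) (δ : ℝ) :
    (Set.ncard {p : ℕ × ℕ | 1 ≤ p.1 ∧ p.1 ≤ N ∧ 1 ≤ p.2 ∧ p.2 ≤ N ∧ p.1 ≠ p.2 ∧
      |α * a p.1 - α * a p.2 - (round (α * a p.1 - α * a p.2) : ℝ)| ≤ δ} : ℝ) =
      2 * pairCount a α N δ := by
  classical
  have hset : {p : ℕ × ℕ | 1 ≤ p.1 ∧ p.1 ≤ N ∧ 1 ≤ p.2 ∧ p.2 ≤ N ∧ p.1 ≠ p.2 ∧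
      |α * a p.1 - α * a p.2 - (round (α * a p.1 - α * a p.2) : ℝ)| ≤ δ} =
      ((Finset.Icc 1 N ×ˢ Finset.Icc 1 N).filter
        fun p => p.1 ≠ p.2 ∧ α ∈ nearInt (a p.1 - a p.2) δ : Finset (ℕ × ℕ)) := by
    ext p
    simp only [nearInt, Set.mem_ofPred_eq, Finset.coe_filter, Finset.mem_product, Finset.mem_Icc,
      mul_sub, and_assoc]
  set g : ℕ → ℕ → ℝ := fun m n => if n < m ∧ α ∈ nearInt (a m - a n) δ then 1 else 0 with hg
  have hcount : pairCount a α N δ = ∑ m ∈ Finset.Icc 1 N, ∑ n ∈ Finset.Icc 1 N, g m n := by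
    refine Finset.sum_congr rfl fun m hm => ?_
    have : Finset.Ico 1 m = (Finset.Icc 1 N).filter fun n => n < m := by
      ext n; simp at hm ⊢; omega
    rw [this, Finset.sum_filter]
    refine Finset.sum_congr rfl fun n _ => ?_
    by_cases h : n < m <;> simp [hg, h, Set.indicator_apply]
  have hswap : ∑ m ∈ Finset.Icc 1 N, ∑ n ∈ Finset.Icc 1 N, g n m =
      ∑ m ∈ Finset.Icc 1 N, ∑ n ∈ Finset.Icc 1 N, g m n := Finset.sum_comm
  rw [hset, Set.ncard_coe_finset, ← Finset.sum_boole, Finset.sum_product, hcount, two_mul]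
  nth_rewrite 2 [← hswap]
  simp only [← Finset.sum_add_distrib]
  refine Finset.sum_congr rfl fun m _ => Finset.sum_congr rfl fun n _ => ?_
  simp only [hg, mem_nearInt_sub_comm (x := a n) (y := a m)]
  rcases lt_trichotomy m n with h | h | h
  · simp [h, h.ne, h.not_gt]
  · simp [h]
  · simp [h, h.ne', h.not_gt]

theorem exists_integral_sq_le {a : ℕ → ℝ} {C : ℝ} (hC : 1 < C)
    (hpos : ∀ x : ℕ, 1 ≤ x → 0 < a x) (hlac : ∀ x : ℕ, 1 ≤ x → C * a x ≤ a (x + 1))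
    {u v r : ℝ} (huv : u ≤ v) (hr : 0 < r) :
    ∃ K : ℝ, ∀ᶠ k : ℕ in atTop,
      ∫ α in Set.Icc u v, (∑ m ∈ Finset.Ioc k (k ^ 4), ∑ n ∈ Finset.Ico 1 m,
        ((nearInt (a m - a n) (r / k ^ 4)).indicator (fun _ => (1 : ℝ)) α
          - 2 * (r / k ^ 4))) ^ 2 ≤ K * k ^ 6 := by
  obtain ⟨w, hw, hgap, hgap'⟩ := exists_gap_of_lacunary hC hpos hlac
  set l := v - u with hl
  have hl0 : 0 ≤ l := by linarith
  refine ⟨2 + 2 * (4 * r ^ 2 * l + 2 + 8 * r * l), ?_⟩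
  have ev1 : ∀ᶠ k : ℕ in atTop, r / (k : ℝ) ^ 4 ≤ 1 / 4 :=
    (((tendsto_pow_atTop (by norm_num)).comp tendsto_natCast_atTop_atTop).const_div_atTop
      r).eventually_le_const (by norm_num)
  have ev2 : ∀ᶠ k : ℕ in atTop, 1 ≤ w * C ^ k :=
    ((tendsto_pow_atTop_atTop_of_one_lt hC).const_mul_atTop hw).eventually_ge_atTop 1
  have ev3 : ∀ᶠ k : ℕ in atTop, (6 * l + 30) / w * ((k : ℝ) ^ 16 / C ^ k) ≤ 1 := by
    have := (tendsto_pow_const_div_const_pow_of_one_lt 16 hC).const_mul ((6 * l + 30) / w)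
    rw [mul_zero] at this
    exact this.eventually_le_const one_pos
  filter_upwards [ev1, ev2, ev3, eventually_ge_atTop 1] with k h1 h2 h3 hk
  have hX : (1 : ℝ) ≤ k := by exact_mod_cast hk
  have hX0 : (0 : ℝ) < k := by linarith
  set δ := r / (k : ℝ) ^ 4 with hδ
  have hδ0 : 0 ≤ δ := by positivity
  set B := w * C ^ k with hB
  have hB0 : 0 < B := by linarith
  set η := (6 * l + 30) / B with hη
  have hη0 : 0 ≤ η := by positivity
  have hη1 : (k : ℝ) ^ 16 * η ≤ 1 := by
    refine le_of_eq_of_le ?_ h3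
    rw [hη, hB]; field_simp
  have huniv : (volume.restrict (Set.Icc u v)).real Set.univ = l := by
    rw [measureReal_restrict_apply MeasurableSet.univ, Set.univ_inter, Real.volume_real_Icc,
      max_eq_left hl0]
  have hsingle : ∀ y, B ≤ y → 6 * δ / y ≤ η := by
    intro y hy
    rw [hη]
    gcongr
    linarith
  have hmain := integral_sq_sum_indicator_le (volume.restrict (Set.Icc u v))
    (fun m n => nearInt (a m - a n) δ) (fun m n => measurableSet_nearInt _ _) k (k ^ 4) δ η
    hδ0 h1 hη0 hk ?_ ?_ ?_ ?_
  · refine hmain.trans ?_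
    rw [huniv]
    push_cast
    have e1 : ((k : ℝ) ^ 4) ^ 2 * (4 * δ ^ 2 * l + 2 * η) =
        4 * r ^ 2 * l + 2 * ((k : ℝ) ^ 8 * η) := by
      rw [hδ]; field_simp
    have e2 : 4 * (k : ℝ) * (k : ℝ) ^ 4 * (2 * δ * l) = 8 * r * l * k := by
      rw [hδ]; field_simp; ring
    have e3 : (k : ℝ) ^ 8 * η ≤ 1 := le_trans (by gcongr; all_goals norm_num) hη1
    rw [e1, e2]
    calc ((k : ℝ) ^ 4) ^ 4 * (2 * η) +
          2 * k * k ^ 4 * (4 * r ^ 2 * l + 2 * ((k : ℝ) ^ 8 * η) + 8 * r * l * k)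
        = 2 * ((k : ℝ) ^ 16 * η) +
          2 * k ^ 5 * (4 * r ^ 2 * l + 2 * ((k : ℝ) ^ 8 * η) + 8 * r * l * k) := by ring
      _ ≤ 2 * 1 + 2 * (k : ℝ) ^ 5 * (4 * r ^ 2 * l * k + 2 * k + 8 * r * l * k) := by
          have e4 : 4 * r ^ 2 * l ≤ 4 * r ^ 2 * l * k := le_mul_of_one_le_right (by positivity) hX
          refine add_le_add (mul_le_mul_of_nonneg_left hη1 zero_le_two)
            (mul_le_mul_of_nonneg_left ?_ (by positivity))
          linarith
      _ ≤ 2 * (k : ℝ) ^ 6 + 2 * (k : ℝ) ^ 5 * (4 * r ^ 2 * l * k + 2 * k + 8 * r * l * k) := by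
          gcongr
          exact one_le_pow₀ hX
      _ = _ := by ring
  · intro m n hm hn hnm
    have hy := hgap k m n hm hn hnm
    rw [huniv, measureReal_restrict_apply (measurableSet_nearInt _ _), Set.inter_comm]
    have := le_measureReal_nearInt (u := u) (v := v) (hB0.trans_le hy) hδ0 (by linarith)
    have h4 := hsingle _ hy
    have h5 : 2 * δ * (v - u - 3 / (a m - a n)) = 2 * δ * l - 6 * δ / (a m - a n) := by ring
    linarith
  · intro m n hm hn hnm
    have hy := hgap k m n hm hn hnm
    rw [huniv, measureReal_restrict_apply (measurableSet_nearInt _ _), Set.inter_comm]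
    have := measureReal_nearInt_le (hB0.trans_le hy) hδ0 (by linarith) huv
    have h4 := hsingle _ hy
    have h5 : 2 * δ * (v - u + 3 / (a m - a n)) = 2 * δ * l + 6 * δ / (a m - a n) := by ring
    linarith
  · intro m n m' n' hm' hm hn hnm hn' hnm'
    rw [huniv, measureReal_restrict_apply
      ((measurableSet_nearInt _ _).inter (measurableSet_nearInt _ _)), Set.inter_comm,
      Set.inter_comm (nearInt _ _)]
    refine (measureReal_nearInt_inter_le_of_gap h2 (hgap k m' n' hm' hn' hnm')
      (hgap' k m n m' n' (by omega) hm hn hnm hn' hnm') hδ0 (by linarith) hδ0 (by linarith)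
      huv).trans (le_of_eq ?_)
    rw [← hl]; ring
  · intro m n n' hkn hm hn' hnn'
    rw [huniv, measureReal_restrict_apply
      ((measurableSet_nearInt _ _).inter (measurableSet_nearInt _ _)), Set.inter_comm]
    have hsub : nearInt (a m - a n) δ ∩ nearInt (a m - a n') δ ⊆
        nearInt (a n - a n') (2 * δ) ∩ nearInt (a m - a n) δ := by
      rintro α ⟨h5, h6⟩
      refine ⟨?_, h5⟩
      rw [two_mul]
      refine nearInt_inter_subset (a m - a n) (a n - a n') δ δ ⟨?_, h5⟩
      rwa [sub_add_sub_cancel]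
    refine (measureReal_mono (Set.inter_subset_inter_right _ hsub)
      ((measure_mono Set.inter_subset_left).trans_lt measure_Icc_lt_top).ne).trans ?_
    refine (measureReal_nearInt_inter_le_of_gap h2 (hgap k n n' hkn hn' hnn')
      (hgap' k m n n n' (by omega) hm (by omega) (by omega) hn' hnn') (by linarith) (by linarith)
      hδ0 (by linarith) huv).trans (le_of_eq ?_)
    rw [← hl]; ring

theorem ae_tendsto_zero_of_summable_integral {Ω : Type*} [MeasurableSpace Ω] {μ : Measure Ω}
    {f : ℕ → Ω → ℝ} (hf : ∀ k, Integrable (f k) μ) (h0 : ∀ k ω, 0 ≤ f k ω)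
    (hs : Summable fun k => ∫ ω, f k ω ∂μ) :
    ∀ᵐ ω ∂μ, Tendsto (fun k => f k ω) atTop (nhds 0) := by
  have hm : ∀ k, AEMeasurable (fun ω => ENNReal.ofReal (f k ω)) μ := fun k =>
    (hf k).aestronglyMeasurable.aemeasurable.ennreal_ofReal
  have hfin : ∫⁻ ω, ∑' k, ENNReal.ofReal (f k ω) ∂μ ≠ ⊤ := by
    rw [lintegral_tsum hm]
    simp_rw [← ofReal_integral_eq_lintegral_ofReal (hf _) (Eventually.of_forall (h0 _))]
    exact hs.tsum_ofReal_ne_top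
  filter_upwards [ae_lt_top' (AEMeasurable.tsum hm) hfin] with ω hω
  have := (ENNReal.tendsto_toReal ENNReal.zero_ne_top).comp
    (ENNReal.tendsto_atTop_zero_of_tsum_ne_top hω.ne)
  simpa [Function.comp_def, h0] using this

theorem ae_tendsto_pairCount_pow_four {a : ℕ → ℝ} {C : ℝ} (hC : 1 < C)
    (hpos : ∀ x : ℕ, 1 ≤ x → 0 < a x) (hlac : ∀ x : ℕ, 1 ≤ x → C * a x ≤ a (x + 1))
    {r : ℝ} (hr : 0 < r) :
    ∀ᵐ α : ℝ, Tendsto (fun k : ℕ => pairCount a α (k ^ 4) (r / k ^ 4) / k ^ 4) atTop (nhds r) := by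
  set S : ℕ → ℝ → ℝ := fun k α => ∑ m ∈ Finset.Ioc k (k ^ 4), ∑ n ∈ Finset.Ico 1 m,
    ((nearInt (a m - a n) (r / k ^ 4)).indicator (fun _ => (1 : ℝ)) α - 2 * (r / k ^ 4)) with hS
  have hloc : ∀ A : ℕ, ∀ᵐ α : ℝ, α ∈ Set.Icc (-(A : ℝ)) A →
      Tendsto (fun k : ℕ => (S k α / k ^ 4) ^ 2) atTop (nhds 0) := by
    intro A
    rw [← ae_restrict_iff' measurableSet_Icc]
    have hA : -(A : ℝ) ≤ A := by linarith [Nat.cast_nonneg (α := ℝ) A]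
    obtain ⟨K, hK⟩ := exists_integral_sq_le hC hpos hlac hA hr
    have hSint : ∀ k, Integrable (fun α => S k α ^ 2) (volume.restrict (Set.Icc (-(A : ℝ)) A)) := by
      intro k
      refine MemLp.integrable_sq ?_
      refine memLp_finsetSum _ fun m _ => memLp_finsetSum _ fun n _ => ?_
      exact ((memLp_const (1 : ℝ)).indicator (measurableSet_nearInt _ _)).sub (memLp_const _)
    refine ae_tendsto_zero_of_summable_integral (fun k => ?_) (fun k α => sq_nonneg _) ?_
    · simp_rw [div_pow]
      exact (hSint k).div_const _
    · have hsum : Summable fun k : ℕ => K * (1 / (k : ℝ) ^ 2) :=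
        (Real.summable_one_div_nat_pow.2 one_lt_two).mul_left K
      refine hsum.of_norm_bounded_eventually_nat ?_
      filter_upwards [hK, eventually_ge_atTop 1] with k hk hk1
      have hX0 : (0 : ℝ) < k := by exact_mod_cast hk1
      rw [Real.norm_of_nonneg (integral_nonneg fun α => sq_nonneg _)]
      simp_rw [div_pow]
      rw [integral_div, div_le_iff₀ (by positivity)]
      refine hk.trans (le_of_eq ?_)
      field_simp
  filter_upwards [ae_all_iff.2 hloc] with α hα
  obtain ⟨A, hA⟩ := exists_nat_ge |α|
  have h0 : Tendsto (fun k : ℕ => S k α / (k : ℝ) ^ 4) atTop (nhds 0) := by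
    have := (hα A (abs_le.1 hA)).sqrt
    simp only [Real.sqrt_sq_eq_abs, Real.sqrt_zero] at this
    exact (tendsto_zero_iff_abs_tendsto_zero _).2 this
  have hinv : Tendsto (fun k : ℕ => ((k : ℝ))⁻¹) atTop (nhds 0) :=
    tendsto_inv_atTop_zero.comp tendsto_natCast_atTop_atTop
  have h1 : Tendsto (fun k : ℕ => pairCount a α k (r / k ^ 4) / (k : ℝ) ^ 4) atTop (nhds 0) := by
    have hsq : Tendsto (fun k : ℕ => ((k : ℝ))⁻¹ ^ 2) atTop (nhds 0) := by
      simpa using hinv.pow 2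
    refine squeeze_zero' (Eventually.of_forall fun k =>
      div_nonneg (pairCount_nonneg _ _ _ _) (by positivity)) ?_ hsq
    filter_upwards [eventually_ge_atTop 1] with k hk1
    have hX0 : (0 : ℝ) < k := by exact_mod_cast hk1
    rw [div_le_iff₀ (by positivity)]
    refine (pairCount_le _ _ _ _).trans (le_of_eq ?_)
    field_simp
  have h2 : Tendsto (fun k : ℕ => r * (1 - (k : ℝ)⁻¹ ^ 4 - (k : ℝ)⁻¹ ^ 6 + (k : ℝ)⁻¹ ^ 7)) atTop
      (nhds r) := by
    have := ((((hinv.pow 4).const_sub 1).sub (hinv.pow 6)).add (hinv.pow 7)).const_mul r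
    simpa using this
  have h3 := (h1.add h0).add h2
  simp only [zero_add] at h3
  refine h3.congr' ?_
  filter_upwards [eventually_ge_atTop 1] with k hk1
  have hX0 : (0 : ℝ) < k := by exact_mod_cast hk1
  have hgauss : ∀ M : ℕ, ∑ m ∈ Finset.Ioc 0 M, ∑ n ∈ Finset.Ico 1 m, (2 : ℝ) = M ^ 2 - M := by
    intro M
    induction M with
    | zero => simp
    | succ M ih =>
      rw [← Finset.insert_Ioc_right_eq_Ioc_add_one (Nat.zero_le M), Finset.sum_insert (by simp), ih]
      simp
      ring
  have hkk : k ≤ k ^ 4 := Nat.le_self_pow (by norm_num) k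
  have hgauss' : ∑ m ∈ Finset.Ioc k (k ^ 4), ∑ n ∈ Finset.Ico 1 m, (2 : ℝ) =
      ((k : ℝ) ^ 8 - k ^ 4) - (k ^ 2 - k) := by
    have := Finset.sum_Ioc_consecutive (fun m => ∑ n ∈ Finset.Ico 1 m, (2 : ℝ)) (Nat.zero_le k) hkk
    rw [hgauss, hgauss] at this
    push_cast at this
    linarith
  have hsplit : pairCount a α (k ^ 4) (r / k ^ 4) = pairCount a α k (r / k ^ 4) + S k α +
      (r / (k : ℝ) ^ 4) * (((k : ℝ) ^ 8 - k ^ 4) - (k ^ 2 - k)) := by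
    rw [← hgauss', hS, Finset.mul_sum, add_assoc, ← Finset.sum_add_distrib, pairCount, pairCount,
      ← Finset.sum_Ioc_consecutive _ (Nat.zero_le k) hkk]
    congr 1
    refine Finset.sum_congr rfl fun m _ => ?_
    rw [Finset.mul_sum, ← Finset.sum_add_distrib]
    refine Finset.sum_congr rfl fun n _ => ?_
    ring
  rw [hsplit]
  field_simp
  ring

theorem tendsto_div_of_tendsto_pow_four {P : ℕ → ℝ → ℝ}
    (hmono : ∀ {N N' : ℕ} {δ δ' : ℝ}, N ≤ N' → δ ≤ δ' → P N δ ≤ P N' δ')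
    (hnonneg : ∀ N δ, 0 ≤ P N δ)
    (h : ∀ q : ℚ, 0 < (q : ℝ) →
      Tendsto (fun k : ℕ => P (k ^ 4) (q / k ^ 4) / (k : ℝ) ^ 4) atTop (nhds (q : ℝ)))
    {s : ℝ} (hs : 0 < s) :
    Tendsto (fun N : ℕ => P N (s / N) / (N : ℝ)) atTop (nhds s) := by
  set κ : ℕ → ℕ := fun N => N.sqrt.sqrt with hκ
  have hκ1 : ∀ N, κ N ^ 4 ≤ N := fun N =>
    calc κ N ^ 4 = (κ N ^ 2) ^ 2 := by ring
      _ ≤ N.sqrt ^ 2 := Nat.pow_le_pow_left (Nat.sqrt_le' _) 2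
      _ ≤ N := Nat.sqrt_le' _
  have hκ2 : ∀ N, N ≤ (κ N + 1) ^ 4 := fun N =>
    calc N ≤ (N.sqrt + 1) ^ 2 := (Nat.lt_succ_sqrt' N).le
      _ ≤ ((κ N + 1) ^ 2) ^ 2 := Nat.pow_le_pow_left (Nat.lt_succ_sqrt' _) 2
      _ = _ := by ring
  have hκtop : Tendsto κ atTop atTop := by
    refine tendsto_atTop.2 fun b => ?_
    filter_upwards [eventually_ge_atTop (b ^ 4)] with N hN
    rw [hκ, Nat.le_sqrt', Nat.le_sqrt']
    exact le_of_eq_of_le (by ring) hN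
  have hratio : Tendsto (fun k : ℕ => ((k : ℝ) + 1) ^ 4 / (k : ℝ) ^ 4) atTop (nhds 1) := by
    have h1 : Tendsto (fun k : ℕ => (1 + (k : ℝ)⁻¹) ^ 4) atTop (nhds 1) := by
      have := ((tendsto_inv_atTop_zero.comp
        (tendsto_natCast_atTop_atTop (R := ℝ))).const_add 1).pow 4
      simpa [Function.comp_def] using this
    refine h1.congr' ?_
    filter_upwards [eventually_ge_atTop 1] with k hk
    have hX0 : (0 : ℝ) < k := by exact_mod_cast hk
    rw [← div_pow]
    field_simp
  have hratio' : Tendsto (fun k : ℕ => (k : ℝ) ^ 4 / ((k : ℝ) + 1) ^ 4) atTop (nhds 1) := by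
    simpa using hratio.inv₀ one_ne_zero
  refine tendsto_order.2 ⟨fun b hb => ?_, fun b hb => ?_⟩
  · obtain ⟨q, hq1, hq2⟩ := exists_rat_btwn (max_lt hb hs)
    obtain ⟨hbq, hq0⟩ := max_lt_iff.1 hq1
    have hlim := (h q hq0).mul hratio'
    rw [mul_one] at hlim
    have hqs : (q : ℝ) / s < 1 := (div_lt_one hs).2 hq2
    filter_upwards [hκtop.eventually (hlim.eventually_const_lt hbq),
      hκtop.eventually (hratio'.eventually_const_lt hqs), hκtop.eventually_ge_atTop 1]
      with N h1 h2 h3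
    have hX0 : (0 : ℝ) < κ N := by exact_mod_cast h3
    have hN1 : (κ N : ℝ) ^ 4 ≤ N := by exact_mod_cast hκ1 N
    have hN2 : (N : ℝ) ≤ ((κ N : ℝ) + 1) ^ 4 := by exact_mod_cast hκ2 N
    have hN0 : (0 : ℝ) < N := lt_of_lt_of_le (by positivity) hN1
    refine h1.trans_le ?_
    have hδ : (q : ℝ) / (κ N : ℝ) ^ 4 ≤ s / N := by
      rw [div_lt_div_iff₀ hs (by positivity)] at h2
      rw [div_le_div_iff₀ (by positivity) hN0]
      nlinarith
    calc P (κ N ^ 4) (q / (κ N : ℝ) ^ 4) / (κ N : ℝ) ^ 4 * ((κ N : ℝ) ^ 4 / ((κ N : ℝ) + 1) ^ 4)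
        = P (κ N ^ 4) (q / (κ N : ℝ) ^ 4) / ((κ N : ℝ) + 1) ^ 4 := by field_simp
      _ ≤ P N (s / N) / N := div_le_div₀ (hnonneg _ _) (hmono (hκ1 N) hδ) hN0 hN2
  · obtain ⟨q, hq1, hq2⟩ := exists_rat_btwn hb
    have hq0 : (0 : ℝ) < q := hs.trans hq1
    have hlim := ((h q hq0).comp (tendsto_add_atTop_nat 1)).mul hratio
    rw [mul_one] at hlim
    have hqs : 1 < (q : ℝ) / s := (one_lt_div hs).2 hq1
    filter_upwards [hκtop.eventually (hlim.eventually_lt_const hq2),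
      hκtop.eventually (hratio.eventually_lt_const hqs), hκtop.eventually_ge_atTop 1]
      with N h1 h2 h3
    have hX0 : (0 : ℝ) < κ N := by exact_mod_cast h3
    have hN1 : (κ N : ℝ) ^ 4 ≤ N := by exact_mod_cast hκ1 N
    have hN0 : (0 : ℝ) < N := lt_of_lt_of_le (by positivity) hN1
    refine lt_of_le_of_lt ?_ h1
    simp only [Function.comp_apply, Nat.cast_add, Nat.cast_one]
    have hδ : s / N ≤ (q : ℝ) / ((κ N : ℝ) + 1) ^ 4 := by
      rw [div_lt_div_iff₀ (by positivity) hs] at h2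
      rw [div_le_div_iff₀ hN0 (by positivity)]
      nlinarith
    calc P N (s / N) / N
        ≤ P ((κ N + 1) ^ 4) (q / ((κ N : ℝ) + 1) ^ 4) / (κ N : ℝ) ^ 4 :=
          div_le_div₀ (hnonneg _ _) (hmono (hκ2 N) hδ) (by positivity) hN1
      _ = _ := by field_simp

/-- If `a` is a lacunary sequence of positive reals, then for Lebesgue
almost every `α`, the pair correlation of the fractional parts of `α·a(x)` is Poissonian. -/
theorem pair_correlation_poissonian_of_lacunary
    (a : ℕ → ℝ) (C : ℝ) (hC : 1 < C)
    (hpos : ∀ x : ℕ, 1 ≤ x → 0 < a x)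
    (hlac : ∀ x : ℕ, 1 ≤ x → C * a x ≤ a (x + 1)) :
    ∀ᵐ α ∂(volume : Measure ℝ), ∀ s : ℝ, 0 < s →
      Tendsto (fun N : ℕ =>
          (Set.ncard {p : ℕ × ℕ | 1 ≤ p.1 ∧ p.1 ≤ N ∧ 1 ≤ p.2 ∧ p.2 ≤ N ∧ p.1 ≠ p.2 ∧
            |α * a p.1 - α * a p.2 - (round (α * a p.1 - α * a p.2) : ℝ)| ≤ s / N} : ℝ)
            / (N : ℝ))
        atTop (nhds (2 * s)) := by
  have hae : ∀ᵐ α : ℝ, ∀ q : ℚ, 0 < (q : ℝ) →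
      Tendsto (fun k : ℕ => pairCount a α (k ^ 4) (q / k ^ 4) / (k : ℝ) ^ 4) atTop
        (nhds (q : ℝ)) := by
    refine ae_all_iff.2 fun q => ?_
    by_cases hq : 0 < (q : ℝ)
    · filter_upwards [ae_tendsto_pairCount_pow_four hC hpos hlac hq] with α hα _ using hα
    · exact Eventually.of_forall fun α h => absurd h hq
  filter_upwards [hae] with α hα s hs
  simp only [ncard_eq_two_mul_pairCount, mul_div_assoc]
  exact (tendsto_div_of_tendsto_pow_four (P := pairCount a α) (pairCount_mono a α)
    (pairCount_nonneg a α) hα hs).const_mul 2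
end

section
/- Let a : ℕ → ℝ be a lacunary sequence of positive reals (a(x) > 0 and a(x+1) ≥ C·a(x) for all x ≥ 1, with a fixed constant C > 1). Then for Lebesgue almost every α ∈ ℝ, for every smooth compactly supported function f : ℝ → ℝ, the smoothed pair correlation function converges to the Poisson limit: lim_{N→∞} R₂(f,N)(α) = ∫_{-∞}^{∞} f(x) dx, where R₂(f,N)(α) = (1/N) · Σ_{1 ≤ m ≠ n ≤ N} Σ_{j ∈ ℤ} f(N·(α·a(n) − α·a(m) + j)). -/
open MeasureTheory Filter

/-- The smoothed pair correlation function
`R₂(f,N)(α) = (1/N) · Σ_{1 ≤ m ≠ n ≤ N} Σ_{j ∈ ℤ} f(N·(α·a(n) − α·a(m) + j))`. -/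
noncomputable def R2 (a : ℕ → ℝ) (f : ℝ → ℝ) (N : ℕ) (α : ℝ) : ℝ :=
  (1 / (N : ℝ)) * ∑ m ∈ Finset.Icc 1 N, ∑ n ∈ Finset.Icc 1 N,
    if m ≠ n then (∑' j : ℤ, f ((N : ℝ) * (α * a n - α * a m + (j : ℝ)))) else 0

/-- The pairs `(m, n)` of indices with `1 ≤ m < n ≤ N`. -/
def pairsLT (N : ℕ) : Finset (ℕ × ℕ) :=
  (Finset.Icc 1 N ×ˢ Finset.Icc 1 N).filter fun p => p.1 < p.2

/-- The indices `((m, n), k)` with `1 ≤ m < n ≤ N`, `L < n` and `0 < |k| ≤ K`. -/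
noncomputable def freqIndex (L N K : ℕ) : Finset ((ℕ × ℕ) × ℤ) :=
  ((pairsLT N).filter fun p => L < p.2) ×ˢ (Finset.Icc (-(K : ℤ)) K).erase 0

/-- The frequency `k (a n - a m)` attached to the index `((m, n), k)`. -/
noncomputable def freq (a : ℕ → ℝ) (p : (ℕ × ℕ) × ℤ) : ℝ := p.2 * (a p.1.2 - a p.1.1)

lemma mem_pairsLT {N : ℕ} {p : ℕ × ℕ} : p ∈ pairsLT N ↔ 1 ≤ p.1 ∧ p.1 < p.2 ∧ p.2 ≤ N := by
  simp only [pairsLT, Finset.mem_filter, Finset.mem_product, Finset.mem_Icc]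
  omega

lemma mem_freqIndex {L N K : ℕ} {p : (ℕ × ℕ) × ℤ} :
    p ∈ freqIndex L N K ↔
      (1 ≤ p.1.1 ∧ p.1.1 < p.1.2 ∧ p.1.2 ≤ N ∧ L < p.1.2) ∧ p.2 ≠ 0 ∧ |p.2| ≤ K := by
  simp only [freqIndex, Finset.mem_product, Finset.mem_filter, mem_pairsLT, Finset.mem_erase,
    Finset.mem_Icc, abs_le]
  tauto

lemma one_le_abs_cast {k : ℤ} (hk : k ≠ 0) : (1 : ℝ) ≤ |(k : ℝ)| := by
  exact_mod_cast Int.one_le_abs hk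

lemma int_eq_of_abs_sub_mul_lt {k l : ℤ} {x : ℝ} (hx : 0 < x)
    (h : |((k : ℝ) - l) * x| < x) : k = l := by
  by_contra hkl
  have h1 : (1 : ℝ) ≤ |((k - l : ℤ) : ℝ)| := one_le_abs_cast (sub_ne_zero.mpr hkl)
  rw [abs_mul, abs_of_pos hx] at h
  push_cast at h1
  nlinarith

section Lacunary

variable {a : ℕ → ℝ} {C : ℝ}

lemma lacunary_pow_mul_le (hC : 1 < C) (hlac : ∀ x : ℕ, 1 ≤ x → C * a x ≤ a (x + 1))
    {m : ℕ} (hm : 1 ≤ m) (d : ℕ) : C ^ d * a m ≤ a (m + d) := by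
  induction d with
  | zero => simp
  | succ d ih =>
    calc C ^ (d + 1) * a m = C * (C ^ d * a m) := by ring
      _ ≤ C * a (m + d) := by gcongr
      _ ≤ a (m + (d + 1)) := hlac _ (by omega)

lemma lacunary_le_div_pow (hC : 1 < C) (hpos : ∀ x : ℕ, 1 ≤ x → 0 < a x)
    (hlac : ∀ x : ℕ, 1 ≤ x → C * a x ≤ a (x + 1)) {m n d : ℕ} (hm : 1 ≤ m) (h : m + d ≤ n) :
    a m ≤ a n / C ^ d := by
  obtain ⟨e, rfl⟩ := Nat.exists_eq_add_of_le h
  rw [le_div_iff₀ (by positivity)]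
  have h1 := lacunary_pow_mul_le hC hlac hm (d + e)
  have h2 : C ^ d ≤ C ^ (d + e) := pow_le_pow_right₀ hC.le (by omega)
  have := hpos m hm
  rw [← add_assoc] at h1
  nlinarith

lemma lacunary_sub_ge (hC : 1 < C) (hpos : ∀ x : ℕ, 1 ≤ x → 0 < a x)
    (hlac : ∀ x : ℕ, 1 ≤ x → C * a x ≤ a (x + 1)) {m n : ℕ} (hm : 1 ≤ m) (h : m < n) :
    (1 - 1 / C) * a n ≤ a n - a m := by
  have := lacunary_le_div_pow hC hpos hlac hm (d := 1) h
  rw [pow_one] at this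
  have e : (1 - 1 / C) * a n = a n - a n / C := by ring
  linarith

lemma lacunary_ge_of_lt (hC : 1 < C) (hpos : ∀ x : ℕ, 1 ≤ x → 0 < a x)
    (hlac : ∀ x : ℕ, 1 ≤ x → C * a x ≤ a (x + 1)) {L n : ℕ} (h : L < n) :
    a 1 * C ^ L ≤ a n := by
  have := lacunary_le_div_pow hC hpos hlac le_rfl (d := L) (n := n) (by omega)
  rwa [le_div_iff₀ (by positivity)] at this

/-- Two close frequencies have close leading indices. -/
lemma leading_index_le_of_near (hC : 1 < C) (hpos : ∀ x : ℕ, 1 ≤ x → 0 < a x)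
    (hlac : ∀ x : ℕ, 1 ≤ x → C * a x ≤ a (x + 1)) {L N K : ℕ} (hK : 1 ≤ K) {T : ℝ} (hT : 0 < T)
    (h1 : 16 * K * T ≤ (1 - 1 / C) * (a 1 * C ^ L))
    (h2 : 32 * (K : ℝ) ^ 2 ≤ (1 - 1 / C) * C ^ L)
    {p q : (ℕ × ℕ) × ℤ} (hp : p ∈ freqIndex L N K) (hq : q ∈ freqIndex L N K)
    (h : |freq a p - freq a q| ≤ T) :
    p.1.2 ≤ q.1.2 + L ∧ (1 - 1 / C) * a p.1.2 ≤ 2 * K * a q.1.2 := by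
  obtain ⟨⟨m, n⟩, k⟩ := p
  obtain ⟨⟨m', n'⟩, k'⟩ := q
  obtain ⟨⟨hm, hmn, -, hLn⟩, hk, -⟩ := mem_freqIndex.mp hp
  obtain ⟨⟨hm', hmn', -, -⟩, -, hk'K⟩ := mem_freqIndex.mp hq
  simp only [freq] at *
  have hk1 := one_le_abs_cast hk
  have hk'K : |(k' : ℝ)| ≤ K := by exact_mod_cast hk'K
  have hK' : (1 : ℝ) ≤ K := by exact_mod_cast hK
  have hc : 0 < 1 - 1 / C := by
    rw [sub_pos, div_lt_one (by linarith)]; exact hC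
  set c := 1 - 1 / C with hcdef
  have hA := lacunary_sub_ge hC hpos hlac hm hmn
  have hn := hpos n (by omega)
  have hn' := hpos n' (by omega)
  have hm0 := hpos m' hm'
  have hA' := lacunary_sub_ge hC hpos hlac hm' hmn'
  have hlow := lacunary_ge_of_lt hC hpos hlac hLn
  rw [← hcdef] at hA hA'
  have hcn := mul_pos hc hn
  have hcn' := mul_pos hc hn'
  have hA1 : c * a n ≤ |(k : ℝ) * (a n - a m)| := by
    rw [abs_mul, abs_of_nonneg (a := a n - a m) (by nlinarith)]
    nlinarith
  have hA2 : |(k' : ℝ) * (a n' - a m')| ≤ K * a n' := by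
    rw [abs_mul, abs_of_nonneg (a := a n' - a m') (by nlinarith)]
    exact mul_le_mul hk'K (by linarith) (by nlinarith) (by linarith)
  have h3 := abs_sub_abs_le_abs_sub ((k : ℝ) * (a n - a m)) ((k' : ℝ) * (a n' - a m'))
  have h4 : c * (a 1 * C ^ L) ≤ c * a n := by gcongr
  have h5 : T ≤ c * a n / 16 := by nlinarith
  have h6 : c * a n ≤ 2 * K * a n' := by linarith
  refine ⟨?_, h6⟩
  by_contra! hcon
  have h7 := lacunary_le_div_pow hC hpos hlac (m := n') (n := n) (d := L) (by omega) hcon.le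
  rw [le_div_iff₀ (by positivity)] at h7
  have h8 : 32 * (K : ℝ) ^ 2 * a n' ≤ c * C ^ L * a n' := by gcongr
  nlinarith [mul_pos (mul_pos (by linarith : (0 : ℝ) < K) (by linarith : (0 : ℝ) < K)) hn',
    mul_pos (by linarith : (0 : ℝ) < K) hn']

/-- The frequency multiplier `k` is determined by the other data of a near coincidence. -/
lemma multiplier_unique_of_near (hC : 1 < C) (hpos : ∀ x : ℕ, 1 ≤ x → 0 < a x)
    (hlac : ∀ x : ℕ, 1 ≤ x → C * a x ≤ a (x + 1)) {L K : ℕ} (hK : 1 ≤ K) {T : ℝ} (hT : 0 < T)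
    (h1 : 16 * K * T ≤ (1 - 1 / C) * (a 1 * C ^ L))
    {m n : ℕ} (hm : 1 ≤ m) (hmn : m < n) (hL : L < n) {k l : ℤ} {x : ℝ}
    (hk : |x - k * (a n - a m)| ≤ T) (hl : |x - l * (a n - a m)| ≤ T) : k = l := by
  have hK' : (1 : ℝ) ≤ K := by exact_mod_cast hK
  have hc : 0 < 1 - 1 / C := by
    rw [sub_pos, div_lt_one (by linarith)]; exact hC
  have hA := lacunary_sub_ge hC hpos hlac hm hmn
  have hlow := lacunary_ge_of_lt hC hpos hlac hL
  have h4 : (1 - 1 / C) * (a 1 * C ^ L) ≤ (1 - 1 / C) * a n := by gcongr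
  have h5 : T ≤ K * T := by nlinarith
  refine int_eq_of_abs_sub_mul_lt (x := a n - a m) (by nlinarith) ?_
  rw [abs_le] at hk hl
  rw [abs_lt]
  constructor <;> nlinarith

/-- The subordinate index `m`, if larger than `L`, is determined by the other data of a near
coincidence. -/
lemma subordinate_unique_of_near (hC : 1 < C) (hpos : ∀ x : ℕ, 1 ≤ x → 0 < a x)
    (hlac : ∀ x : ℕ, 1 ≤ x → C * a x ≤ a (x + 1)) {L K : ℕ} (hK : 1 ≤ K) {T : ℝ} (hT : 0 < T)
    (h1 : 16 * K * T ≤ (1 - 1 / C) * (a 1 * C ^ L))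
    {m₁ m₂ : ℕ} (hm : L < m₁) (hm' : 1 ≤ m₁) (hlt : m₁ < m₂) {k : ℤ} (hk : k ≠ 0) {x y : ℝ}
    (h₁ : |k * (x - a m₁) - y| ≤ T) (h₂ : |k * (x - a m₂) - y| ≤ T) : False := by
  have hK' : (1 : ℝ) ≤ K := by exact_mod_cast hK
  have hc : 0 < 1 - 1 / C := by
    rw [sub_pos, div_lt_one (by linarith)]; exact hC
  have hA := lacunary_sub_ge hC hpos hlac hm' hlt
  have hlow := lacunary_ge_of_lt hC hpos hlac (hm.trans hlt)
  have h4 : (1 - 1 / C) * (a 1 * C ^ L) ≤ (1 - 1 / C) * a m₂ := by gcongr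
  have h5 : T ≤ K * T := by nlinarith
  have hk1 := one_le_abs_cast hk
  have h6 : |(k : ℝ) * (a m₂ - a m₁)| ≤ 2 * T := by
    rw [abs_le] at *
    constructor <;> linarith
  rw [abs_mul, abs_of_nonneg (a := a m₂ - a m₁) (by nlinarith)] at h6
  nlinarith

/-- The multiplier `k'` is determined by `n`, `n'`, `k` if both subordinate indices are small. -/
lemma multiplier_unique_of_small_subordinate (hC : 1 < C) (hpos : ∀ x : ℕ, 1 ≤ x → 0 < a x)
    (hlac : ∀ x : ℕ, 1 ≤ x → C * a x ≤ a (x + 1)) {L K : ℕ} (hK : 1 ≤ K) {T : ℝ} (hT : 0 < T)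
    (h1 : 16 * K * T ≤ (1 - 1 / C) * (a 1 * C ^ L))
    (h2 : 32 * (K : ℝ) ^ 2 ≤ (1 - 1 / C) * C ^ L)
    {n n' : ℕ} (hL : L < n) (hn' : 1 ≤ n') (hnn' : (1 - 1 / C) * a n ≤ 2 * K * a n')
    {m₁ m₁' m₂ m₂' : ℕ} (hm₁ : 1 ≤ m₁) (hm₁' : 1 ≤ m₁') (hm₂ : 1 ≤ m₂) (hm₂' : 1 ≤ m₂')
    (g₁ : m₁ + L ≤ n) (g₁' : m₁' + L ≤ n) (g₂ : m₂ + L ≤ n) (g₂' : m₂' + L ≤ n)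
    {k k₁ k₂ : ℤ} (hk : |(k : ℝ)| ≤ K) (hk₁ : |(k₁ : ℝ)| ≤ K) (hk₂ : |(k₂ : ℝ)| ≤ K)
    (h₁ : |k * (a n - a m₁) - k₁ * (a n' - a m₁')| ≤ T)
    (h₂ : |k * (a n - a m₂) - k₂ * (a n' - a m₂')| ≤ T) : k₁ = k₂ := by
  have hK' : (1 : ℝ) ≤ K := by exact_mod_cast hK
  have hc : 0 < 1 - 1 / C := by
    rw [sub_pos, div_lt_one (by linarith)]; exact hC
  set c := 1 - 1 / C with hcdef
  have hlow := lacunary_ge_of_lt hC hpos hlac hL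
  have han := hpos n (by omega)
  have h4 : c * (a 1 * C ^ L) ≤ c * a n := by gcongr
  have key : ∀ {m : ℕ} {l : ℤ}, 1 ≤ m → m + L ≤ n → |(l : ℝ)| ≤ K →
      |l * a m| ≤ K * (a n / C ^ L) := by
    intro m l hm hmL hl
    rw [abs_mul, abs_of_pos (hpos m hm)]
    exact mul_le_mul hl (lacunary_le_div_pow hC hpos hlac hm hmL) (hpos m hm).le (by linarith)
  have b₁ := abs_le.mp (key hm₁ g₁ hk)
  have b₁' := abs_le.mp (key hm₁' g₁' hk₁)
  have b₂ := abs_le.mp (key hm₂ g₂ hk)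
  have b₂' := abs_le.mp (key hm₂' g₂' hk₂)
  set D := K * (a n / C ^ L) with hD
  have hDle : 32 * K * D ≤ c * a n := by
    have : 32 * (K : ℝ) ^ 2 * (a n / C ^ L) ≤ c * C ^ L * (a n / C ^ L) := by gcongr
    have e : c * C ^ L * (a n / C ^ L) = c * a n := by field_simp
    rw [e] at this
    rw [hD]; linarith
  refine int_eq_of_abs_sub_mul_lt (hpos n' hn') ?_
  have hb : |((k₁ : ℝ) - k₂) * a n'| ≤ 2 * T + 4 * D := by
    rw [abs_le] at *
    constructor <;> linarith
  refine hb.trans_lt ?_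
  have hKpos : (0 : ℝ) < K := by linarith
  have : K * (2 * T + 4 * D) < K * a n' := by nlinarith
  exact lt_of_mul_lt_mul_left this hKpos.le

lemma card_box (L N K : ℕ) :
    (Finset.Icc 1 N ×ˢ Finset.range (L + 1) ×ˢ Finset.range (L + 1) ×ˢ Finset.Icc 1 N ×ˢ
      Finset.Icc (-(K : ℤ)) K).card = N ^ 2 * (L + 1) ^ 2 * (2 * K + 1) := by
  simp only [Finset.card_product, Nat.card_Icc, Finset.card_range, Int.card_Icc]
  rw [show ((K : ℤ) + 1 - -K).toNat = 2 * K + 1 by omega]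
  simp only [Nat.add_sub_cancel]
  ring

/-- The number of near coincidences between frequencies. -/
lemma card_near_le (hC : 1 < C) (hpos : ∀ x : ℕ, 1 ≤ x → 0 < a x)
    (hlac : ∀ x : ℕ, 1 ≤ x → C * a x ≤ a (x + 1)) {L N K : ℕ} (hK : 1 ≤ K) {T : ℝ} (hT : 0 < T)
    (h1 : 16 * K * T ≤ (1 - 1 / C) * (a 1 * C ^ L))
    (h2 : 32 * (K : ℝ) ^ 2 ≤ (1 - 1 / C) * C ^ L) :
    ((freqIndex L N K ×ˢ freqIndex L N K).filter
      fun z => |freq a z.1 - freq a z.2| ≤ T).card ≤ 6 * (N ^ 2 * (L + 1) ^ 2 * (2 * K + 1)) := by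
  classical
  set I := freqIndex L N K with hI
  set S := (I ×ˢ I).filter fun z => |freq a z.1 - freq a z.2| ≤ T with hS
  set S' := S.filter fun z => z.2.1.2 ≤ z.1.1.2 with hS'
  set M := N ^ 2 * (L + 1) ^ 2 * (2 * K + 1) with hM
  have memS' : ∀ z ∈ S', z.1 ∈ I ∧ z.2 ∈ I ∧ |freq a z.1 - freq a z.2| ≤ T ∧
      z.2.1.2 ≤ z.1.1.2 := by
    intro z hz
    simp only [hS', hS, Finset.mem_filter, Finset.mem_product] at hz
    tauto
  have hcover : S ⊆ S' ∪ S'.image Prod.swap := by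
    intro z hz
    rcases le_total z.2.1.2 z.1.1.2 with h | h
    · exact Finset.mem_union_left _ (Finset.mem_filter.mpr ⟨hz, h⟩)
    · refine Finset.mem_union_right _ (Finset.mem_image.mpr ⟨z.swap, ?_, by simp⟩)
      simp only [hS', hS, Finset.mem_filter, Finset.mem_product, Prod.fst_swap,
        Prod.snd_swap] at hz ⊢
      rw [abs_sub_comm]
      tauto
  have c1 : (S'.filter fun z => z.1.1.2 ≤ z.1.1.1 + L).card ≤ M := by
    rw [hM, ← card_box L N K]
    refine Finset.card_le_card_of_injOn
      (fun z => (z.1.1.2, z.1.1.2 - z.2.1.2, z.1.1.2 - z.1.1.1, z.2.1.1, z.1.2)) ?_ ?_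
    · intro z hz
      obtain ⟨hz, hz'⟩ := Finset.mem_filter.mp hz
      obtain ⟨hp, hq, hT', hle⟩ := memS' z hz
      have h3 := leading_index_le_of_near hC hpos hlac hK hT h1 h2 hp hq hT'
      have hp' := mem_freqIndex.mp hp
      have hq' := mem_freqIndex.mp hq
      have := abs_le.mp hp'.2.2
      simp only [Finset.coe_product, Set.mem_prod, Finset.mem_coe, Finset.mem_Icc,
        Finset.mem_range]
      omega
    · rintro ⟨⟨⟨m, n⟩, k⟩, ⟨⟨m', n'⟩, k'⟩⟩ hz ⟨⟨⟨m₁, n₁⟩, k₁⟩, ⟨⟨m₁', n₁'⟩, k₁'⟩⟩ hw heq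
      obtain ⟨hz, hz'⟩ := Finset.mem_filter.mp hz
      obtain ⟨hp, hq, hT', hle⟩ := memS' _ hz
      obtain ⟨hw, hw'⟩ := Finset.mem_filter.mp hw
      obtain ⟨hp₁, hq₁, hT₁', hle₁⟩ := memS' _ hw
      rw [hI, mem_freqIndex] at hp hq hp₁ hq₁
      simp only [Prod.mk.injEq, freq] at *
      obtain rfl : n = n₁ := by omega
      obtain rfl : n' = n₁' := by omega
      obtain rfl : m = m₁ := by omega
      obtain rfl : m' = m₁' := by omega
      obtain rfl : k = k₁ := by tauto
      obtain rfl : k' = k₁' := multiplier_unique_of_near hC hpos hlac hK hT h1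
        (m := m') (n := n') (by omega) (by omega) (by omega) hT' hT₁'
      simp
  have c2 : (S'.filter fun z => z.1.1.2 ≤ z.2.1.1 + L).card ≤ M := by
    rw [hM, ← card_box L N K]
    refine Finset.card_le_card_of_injOn
      (fun z => (z.1.1.2, z.1.1.2 - z.2.1.2, z.1.1.2 - z.2.1.1, z.1.1.1, z.1.2)) ?_ ?_
    · intro z hz
      obtain ⟨hz, hz'⟩ := Finset.mem_filter.mp hz
      obtain ⟨hp, hq, hT', hle⟩ := memS' z hz
      have h3 := leading_index_le_of_near hC hpos hlac hK hT h1 h2 hp hq hT'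
      have hp' := mem_freqIndex.mp hp
      have hq' := mem_freqIndex.mp hq
      have := abs_le.mp hp'.2.2
      simp only [Finset.coe_product, Set.mem_prod, Finset.mem_coe, Finset.mem_Icc,
        Finset.mem_range]
      omega
    · rintro ⟨⟨⟨m, n⟩, k⟩, ⟨⟨m', n'⟩, k'⟩⟩ hz ⟨⟨⟨m₁, n₁⟩, k₁⟩, ⟨⟨m₁', n₁'⟩, k₁'⟩⟩ hw heq
      obtain ⟨hz, hz'⟩ := Finset.mem_filter.mp hz
      obtain ⟨hp, hq, hT', hle⟩ := memS' _ hz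
      obtain ⟨hw, hw'⟩ := Finset.mem_filter.mp hw
      obtain ⟨hp₁, hq₁, hT₁', hle₁⟩ := memS' _ hw
      rw [hI, mem_freqIndex] at hp hq hp₁ hq₁
      simp only [Prod.mk.injEq, freq] at *
      obtain rfl : n = n₁ := by omega
      obtain rfl : n' = n₁' := by omega
      obtain rfl : m = m₁ := by omega
      obtain rfl : m' = m₁' := by omega
      obtain rfl : k = k₁ := by tauto
      obtain rfl : k' = k₁' := multiplier_unique_of_near hC hpos hlac hK hT h1
        (m := m') (n := n') (by omega) (by omega) (by omega) hT' hT₁'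
      simp
  have c3 : (S'.filter fun z => z.1.1.1 + L < z.1.1.2 ∧ z.2.1.1 + L < z.1.1.2).card ≤ M := by
    rw [hM, ← card_box L N K]
    refine Finset.card_le_card_of_injOn
      (fun z => (z.1.1.2, z.1.1.2 - z.2.1.2, min (z.1.1.1 - 1) L, z.2.1.1, z.1.2)) ?_ ?_
    · intro z hz
      obtain ⟨hz, hz'⟩ := Finset.mem_filter.mp hz
      obtain ⟨hp, hq, hT', hle⟩ := memS' z hz
      have h3 := leading_index_le_of_near hC hpos hlac hK hT h1 h2 hp hq hT'
      have hp' := mem_freqIndex.mp hp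
      have hq' := mem_freqIndex.mp hq
      have := abs_le.mp hp'.2.2
      simp only [Finset.coe_product, Set.mem_prod, Finset.mem_coe, Finset.mem_Icc,
        Finset.mem_range]
      omega
    · rintro ⟨⟨⟨m, n⟩, k⟩, ⟨⟨m', n'⟩, k'⟩⟩ hz ⟨⟨⟨m₁, n₁⟩, k₁⟩, ⟨⟨m₁', n₁'⟩, k₁'⟩⟩ hw heq
      obtain ⟨hz, hz'⟩ := Finset.mem_filter.mp hz
      obtain ⟨hp, hq, hT', hle⟩ := memS' _ hz
      obtain ⟨hw, hw'⟩ := Finset.mem_filter.mp hw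
      obtain ⟨hp₁, hq₁, hT₁', hle₁⟩ := memS' _ hw
      have h3 := (leading_index_le_of_near hC hpos hlac hK hT h1 h2 hp hq hT').2
      rw [hI, mem_freqIndex] at hp hq hp₁ hq₁
      simp only [Prod.mk.injEq, freq] at *
      obtain rfl : n = n₁ := by omega
      obtain rfl : n' = n₁' := by omega
      obtain rfl : m' = m₁' := by omega
      obtain rfl : k = k₁ := by tauto
      obtain rfl : k' = k₁' := multiplier_unique_of_small_subordinate hC hpos hlac hK hT h1 h2
        (n := n) (n' := n') (by omega) (by omega) h3 (m₁ := m) (m₂ := m₁) (m₁' := m') (m₂' := m')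
        (by omega) (by omega) (by omega) (by omega) (by omega) (by omega) (by omega) (by omega)
        (by exact_mod_cast hp.2.2) (by exact_mod_cast hq.2.2) (by exact_mod_cast hq₁.2.2) hT' hT₁'
      obtain rfl : m = m₁ := by
        rcases lt_trichotomy m m₁ with h | h | h
        · by_cases hL : L < m
          · exact (subordinate_unique_of_near hC hpos hlac hK hT h1 hL (by omega) h hp.2.1
              hT' hT₁').elim
          · omega
        · exact h
        · by_cases hL : L < m₁
          · exact (subordinate_unique_of_near hC hpos hlac hK hT h1 hL (by omega) h hp.2.1
              hT₁' hT').elim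
          · omega
      simp
  have hS'card : S'.card ≤ 3 * M := by
    have hsub : S' ⊆ (S'.filter fun z => z.1.1.2 ≤ z.1.1.1 + L) ∪
        ((S'.filter fun z => z.1.1.2 ≤ z.2.1.1 + L) ∪
        (S'.filter fun z => z.1.1.1 + L < z.1.1.2 ∧ z.2.1.1 + L < z.1.1.2)) := by
      intro z hz
      simp only [Finset.mem_union, Finset.mem_filter, hz, true_and]
      omega
    have := Finset.card_le_card hsub
    have u1 := Finset.card_union_le (S'.filter fun z => z.1.1.2 ≤ z.1.1.1 + L)
      ((S'.filter fun z => z.1.1.2 ≤ z.2.1.1 + L) ∪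
        (S'.filter fun z => z.1.1.1 + L < z.1.1.2 ∧ z.2.1.1 + L < z.1.1.2))
    have u2 := Finset.card_union_le (S'.filter fun z => z.1.1.2 ≤ z.2.1.1 + L)
        (S'.filter fun z => z.1.1.1 + L < z.1.1.2 ∧ z.2.1.1 + L < z.1.1.2)
    omega
  have := Finset.card_le_card hcover
  have u1 := Finset.card_union_le S' (S'.image Prod.swap)
  have u2 : (S'.image Prod.swap).card ≤ S'.card := Finset.card_image_le
  omega

end Lacunary

lemma norm_integral_cexp_le (M : ℝ) {ξ : ℝ} (hξ : ξ ≠ 0) :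
    ‖∫ α in (-M)..M, Complex.exp (2 * Real.pi * Complex.I * ↑(ξ * α))‖ ≤ 1 / |ξ| := by
  have hc : (2 * Real.pi * Complex.I * ξ : ℂ) ≠ 0 := by
    simp [Real.pi_ne_zero, hξ]
  have e : ∀ α : ℝ, Complex.exp (2 * Real.pi * Complex.I * ↑(ξ * α)) =
      Complex.exp ((2 * Real.pi * Complex.I * ξ) * α) := by
    intro α; push_cast; ring_nf
  have n1 : ∀ x : ℝ, ‖Complex.exp (2 * Real.pi * Complex.I * ξ * x)‖ = 1 := by
    intro x
    rw [show (2 * Real.pi * Complex.I * ξ * x : ℂ) = ((2 * Real.pi * ξ * x : ℝ) : ℂ) * Complex.I by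
      push_cast; ring]
    exact Complex.norm_exp_ofReal_mul_I _
  simp_rw [e]
  rw [integral_exp_mul_complex hc, norm_div]
  have hden : ‖(2 * Real.pi * Complex.I * ξ : ℂ)‖ = 2 * Real.pi * |ξ| := by
    simp [abs_of_pos Real.pi_pos]
  have hnum : ‖Complex.exp (2 * Real.pi * Complex.I * ξ * (M : ℝ)) -
      Complex.exp (2 * Real.pi * Complex.I * ξ * ((-M : ℝ) : ℂ))‖ ≤ 2 := by
    refine (norm_sub_le _ _).trans ?_
    rw [n1, n1]; norm_num
  have hξ' := abs_pos.mpr hξ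
  rw [hden, div_le_div_iff₀ (by positivity) hξ']
  nlinarith [Real.pi_gt_three]

lemma norm_cexp_two_pi_mul (x : ℝ) : ‖Complex.exp (2 * Real.pi * Complex.I * x)‖ = 1 := by
  rw [show (2 * Real.pi * Complex.I * x : ℂ) = ((2 * Real.pi * x : ℝ) : ℂ) * Complex.I by
    push_cast; ring]
  exact Complex.norm_exp_ofReal_mul_I _

/-- Second moment bound for an exponential sum in terms of near coincidences of frequencies. -/
lemma integral_norm_sq_expSum_le {ι : Type*} (I : Finset ι) (w : ι → ℂ) (θ : ι → ℝ)
    {W M T : ℝ} (hW : ∀ p ∈ I, ‖w p‖ ≤ W) (hM : 0 ≤ M) (hT : 0 < T) :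
    ∫ α in (-M)..M, ‖∑ p ∈ I, w p * Complex.exp (2 * Real.pi * Complex.I * ↑(θ p * α))‖ ^ 2 ≤
      W ^ 2 * (2 * M * ((I ×ˢ I).filter fun z => |θ z.1 - θ z.2| ≤ T).card +
        (I.card : ℝ) ^ 2 / T) := by
  classical
  set S : ℝ → ℂ := fun α => ∑ p ∈ I, w p * Complex.exp (2 * Real.pi * Complex.I * ↑(θ p * α))
    with hS
  have hexp : ∀ α : ℝ, ((‖S α‖ ^ 2 : ℝ) : ℂ) = ∑ z ∈ I ×ˢ I,
      w z.1 * (starRingEnd ℂ) (w z.2) *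
        Complex.exp (2 * Real.pi * Complex.I * ↑((θ z.1 - θ z.2) * α)) := by
    intro α
    rw [Complex.ofReal_pow, ← Complex.mul_conj', hS, map_sum, Finset.sum_mul_sum,
      Finset.sum_product]
    refine Finset.sum_congr rfl fun p _ => Finset.sum_congr rfl fun q _ => ?_
    have hconj : (starRingEnd ℂ) (Complex.exp (2 * Real.pi * Complex.I * ↑(θ q * α))) =
        Complex.exp (-(2 * Real.pi * Complex.I * ↑(θ q * α))) := by
      rw [← Complex.exp_conj]
      congr 1
      simp only [map_mul, map_ofNat, Complex.conj_ofReal, Complex.conj_I]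
      ring
    rw [map_mul, hconj]
    have : (2 * Real.pi * Complex.I * ↑((θ p - θ q) * α) : ℂ) =
      2 * Real.pi * Complex.I * ↑(θ p * α) + -(2 * Real.pi * Complex.I * ↑(θ q * α)) := by
      push_cast; ring
    rw [this, Complex.exp_add]
    ring
  have hint : ((∫ α in (-M)..M, ‖S α‖ ^ 2 : ℝ) : ℂ) = ∑ z ∈ I ×ˢ I,
      w z.1 * (starRingEnd ℂ) (w z.2) *
        ∫ α in (-M)..M, Complex.exp (2 * Real.pi * Complex.I * ↑((θ z.1 - θ z.2) * α)) := by
    rw [← intervalIntegral.integral_ofReal]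
    simp_rw [hexp]
    rw [intervalIntegral.integral_finsetSum]
    · simp_rw [intervalIntegral.integral_const_mul]
    · intro z _
      apply Continuous.intervalIntegrable
      fun_prop
  have hterm : ∀ z ∈ I ×ˢ I, ‖w z.1 * (starRingEnd ℂ) (w z.2) *
        ∫ α in (-M)..M, Complex.exp (2 * Real.pi * Complex.I * ↑((θ z.1 - θ z.2) * α))‖ ≤
      W ^ 2 * ((if |θ z.1 - θ z.2| ≤ T then 2 * M else 0) + 1 / T) := by
    intro z hz
    obtain ⟨h1, h2⟩ := Finset.mem_product.mp hz
    have hww : ‖w z.1 * (starRingEnd ℂ) (w z.2)‖ ≤ W ^ 2 := by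
      rw [norm_mul, RCLike.norm_conj, sq]
      exact mul_le_mul (hW _ h1) (hW _ h2) (norm_nonneg _) ((norm_nonneg _).trans (hW _ h1))
    rw [norm_mul]
    refine mul_le_mul hww ?_ (norm_nonneg _) (sq_nonneg _)
    split_ifs with h
    · have : ‖∫ α in (-M)..M, Complex.exp (2 * Real.pi * Complex.I * ↑((θ z.1 - θ z.2) * α))‖ ≤
          1 * |M - -M| := by
        refine intervalIntegral.norm_integral_le_of_norm_le_const fun α _ => ?_
        exact (norm_cexp_two_pi_mul _).le
      rw [one_mul, abs_of_nonneg (by linarith)] at this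
      have : 0 < 1 / T := by positivity
      linarith
    · push Not at h
      have hne : θ z.1 - θ z.2 ≠ 0 := by
        intro h0; rw [h0, abs_zero] at h; linarith
      rw [zero_add]
      exact (norm_integral_cexp_le M hne).trans (one_div_le_one_div_of_le hT h.le)
  calc ∫ α in (-M)..M, ‖S α‖ ^ 2 ≤ ‖((∫ α in (-M)..M, ‖S α‖ ^ 2 : ℝ) : ℂ)‖ := by
        rw [Complex.norm_real]; exact le_abs_self _
    _ ≤ ∑ z ∈ I ×ˢ I, W ^ 2 * ((if |θ z.1 - θ z.2| ≤ T then 2 * M else 0) + 1 / T) := by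
        rw [hint]; exact norm_sum_le_of_le _ hterm
    _ = _ := by
        rw [← Finset.mul_sum, Finset.sum_add_distrib, ← Finset.sum_filter, Finset.sum_const,
          Finset.sum_const, Finset.card_product]
        simp only [nsmul_eq_mul]
        push_cast
        ring

/-- A sequence of continuous functions whose second moments on bounded intervals are `O(j⁻²)`
tends to zero almost everywhere. -/
lemma ae_tendsto_zero_of_integral_sq_le {S : ℕ → ℝ → ℂ} (hS : ∀ j, Continuous (S j))
    (h : ∀ M : ℕ, ∃ B : ℝ, ∀ᶠ j : ℕ in atTop,
      ∫ α in (-(M : ℝ))..M, ‖S j α‖ ^ 2 ≤ B * (1 / (j : ℝ) ^ 2)) :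
    ∀ᵐ α ∂(volume : Measure ℝ), Tendsto (fun j => S j α) atTop (nhds 0) := by
  have hunion : (⋃ M : ℕ, Set.Ioc (-(M : ℝ)) M) = Set.univ := by
    refine Set.eq_univ_of_forall fun x => ?_
    obtain ⟨M, hM⟩ := exists_nat_gt |x|
    rw [abs_lt] at hM
    exact Set.mem_iUnion.mpr ⟨M, hM.1, hM.2.le⟩
  rw [← Measure.restrict_univ (μ := (volume : Measure ℝ)), ← hunion, ae_restrict_iUnion_iff]
  intro M
  obtain ⟨B, hB⟩ := h M
  obtain ⟨j₀, hj₀⟩ := eventually_atTop.mp hB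
  have hsum : Summable fun j : ℕ => B * (1 / ((j + j₀ : ℕ) : ℝ) ^ 2) :=
    ((summable_nat_add_iff j₀).mpr
      (Real.summable_one_div_nat_pow.mpr one_lt_two)).mul_left B
  have hnn : ∀ j : ℕ, 0 ≤ B * (1 / ((j + j₀ : ℕ) : ℝ) ^ 2) := fun j =>
    (intervalIntegral.integral_nonneg (by linarith [M.cast_nonneg (α := ℝ)])
      fun _ _ => sq_nonneg _).trans (hj₀ (j + j₀) (by omega))
  have hlint : ∫⁻ α in Set.Ioc (-(M : ℝ)) M, ∑' j, ENNReal.ofReal (‖S (j + j₀) α‖ ^ 2) ≠ ⊤ := by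
    rw [lintegral_tsum fun j => (by
      have := hS (j + j₀)
      exact (Continuous.measurable (by fun_prop)).ennreal_ofReal.aemeasurable)]
    refine ne_top_of_le_ne_top (b := ∑' j : ℕ, ENNReal.ofReal (B * (1 / ((j + j₀ : ℕ) : ℝ) ^ 2)))
      ?_ (ENNReal.tsum_le_tsum fun j => ?_)
    · rw [← ENNReal.ofReal_tsum_of_nonneg hnn hsum]
      exact ENNReal.ofReal_ne_top
    · have hc := hS (j + j₀)
      rw [← ofReal_integral_eq_lintegral_ofReal]
      · refine ENNReal.ofReal_le_ofReal ?_
        rw [← intervalIntegral.integral_of_le (by linarith [M.cast_nonneg (α := ℝ)])]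
        exact hj₀ (j + j₀) (by omega)
      · exact (Continuous.integrableOn_Icc (by fun_prop)).mono_set Set.Ioc_subset_Icc_self
      · exact Eventually.of_forall fun _ => sq_nonneg _
  have hfin := ae_lt_top' (AEMeasurable.tsum fun j => (by
      have := hS (j + j₀)
      exact (Continuous.measurable (by fun_prop)).ennreal_ofReal.aemeasurable)) hlint
  filter_upwards [hfin] with α hα
  have h0 := ENNReal.tendsto_atTop_zero_of_tsum_ne_top hα.ne
  have h1 : Tendsto (fun j => ‖S (j + j₀) α‖ ^ 2) atTop (nhds 0) := by
    have := (ENNReal.tendsto_toReal ENNReal.zero_ne_top).comp h0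
    refine this.congr fun j => ?_
    simp
  have h2 : Tendsto (fun j => ‖S (j + j₀) α‖) atTop (nhds 0) := by
    have := h1.sqrt
    simpa [Real.sqrt_sq (norm_nonneg _)] using this
  exact (tendsto_add_atTop_iff_nat j₀).mp (tendsto_zero_iff_norm_tendsto_zero.mpr h2)

/-- The periodization `∑ j, f (N (x + j))` of the rescaled function `f (N ·)`. -/
noncomputable def scaledPeriodization (f : ℝ → ℝ) (N : ℕ) (x : ℝ) : ℝ :=
  ∑' j : ℤ, f (N * (x + j))

open FourierTransform in
lemma scaledPeriodization_eq_tsum_fourier {f : ℝ → ℝ} (hf : ContDiff ℝ (⊤ : ℕ∞) f)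
    (hs : HasCompactSupport f) {N : ℕ} (hN : 1 ≤ N) (x : ℝ) :
    (scaledPeriodization f N x : ℂ) =
      ∑' k : ℤ, (𝓕 (fun y => (f y : ℂ)) ((k : ℝ) / N) / N) *
        Complex.exp (2 * Real.pi * Complex.I * ↑(k * x)) := by
  have hN0 : (N : ℝ) ≠ 0 := by positivity
  set g : ℝ → ℂ := fun y => f (N * y) with hg
  have hg1 : ContDiff ℝ (⊤ : ℕ∞) g :=
    Complex.ofRealCLM.contDiff.comp (hf.comp (contDiff_const.mul contDiff_id))
  have hg2 : HasCompactSupport g := by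
    have h1 : HasCompactSupport fun y => f ((N : ℝ) • y) := hs.comp_smul hN0
    exact h1.comp_left (g := fun y : ℝ => (y : ℂ)) Complex.ofReal_zero
  have hP := SchwartzMap.tsum_eq_tsum_fourier (hg2.toSchwartzMap hg1) x
  rw [SchwartzMap.fourier_coe] at hP
  change ∑' n : ℤ, g (x + n) = ∑' n : ℤ, 𝓕 g n * _ at hP
  have hF : ∀ k : ℤ, 𝓕 g k = 𝓕 (fun y => (f y : ℂ)) ((k : ℝ) / N) / N := by
    intro k
    rw [Real.fourier_real_eq_integral_exp_smul, Real.fourier_real_eq_integral_exp_smul]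
    have := Measure.integral_comp_mul_left (fun v : ℝ =>
      Complex.exp (↑(-2 * Real.pi * v * ((k : ℝ) / N)) * Complex.I) • (f v : ℂ)) (N : ℝ)
    rw [abs_of_nonneg (by positivity), Complex.real_smul, Complex.ofReal_inv,
      Complex.ofReal_natCast, ← div_eq_inv_mul] at this
    rw [← this]
    congr 1
    ext v
    have : -2 * Real.pi * v * k = -2 * Real.pi * (N * v) * ((k : ℝ) / N) := by field_simp
    rw [this]
  rw [scaledPeriodization, Complex.ofReal_tsum, ← hg] at *
  refine hP.trans (tsum_congr fun k => ?_)
  rw [hF, fourier_coe_apply]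
  congr 2
  push_cast
  simp
  ring

/-- Approximation of the rescaled periodization by a trigonometric polynomial. -/
lemma exists_trigPoly_approx {f : ℝ → ℝ} (hf : ContDiff ℝ (⊤ : ℕ∞) f)
    (hs : HasCompactSupport f) :
    ∃ B : ℝ, 0 ≤ B ∧ ∃ c : ℕ → ℤ → ℂ, ∀ N : ℕ, 1 ≤ N → (∀ k, ‖c N k‖ ≤ B / N) ∧
      ∀ K : ℕ, 1 ≤ K → ∀ x : ℝ,
        ‖(scaledPeriodization f N x : ℂ) - ((∫ y, f y : ℝ) : ℂ) / N -
          ∑ k ∈ (Finset.Icc (-(K : ℤ)) K).erase 0,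
            c N k * Complex.exp (2 * Real.pi * Complex.I * ↑(k * x))‖ ≤
          B * N ^ 19 / K ^ 18 := by
  set g : ℝ → ℂ := fun y => f y with hg
  have hg1 : ContDiff ℝ (⊤ : ℕ∞) g := Complex.ofRealCLM.contDiff.comp hf
  have hg2 : HasCompactSupport g := hs.comp_left (g := fun y : ℝ => (y : ℂ)) Complex.ofReal_zero
  obtain ⟨B₀, hB₀, h0⟩ := (FourierTransform.fourier (hg2.toSchwartzMap hg1)).decay 0 0
  obtain ⟨B₁, hB₁, h1⟩ := (FourierTransform.fourier (hg2.toSchwartzMap hg1)).decay 20 0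
  rw [SchwartzMap.fourier_coe] at h0 h1
  change ∀ x : ℝ, _ * ‖iteratedFDeriv ℝ 0 (FourierTransform.fourier g) x‖ ≤ _ at h0 h1
  simp only [norm_iteratedFDeriv_zero, pow_zero, one_mul] at h0 h1
  set F := FourierTransform.fourier g with hF
  have hsum : Summable fun k : ℤ => 1 / (k : ℝ) ^ 2 := by
    simpa using Real.summable_one_div_int_pow.mpr one_lt_two
  set Z := ∑' k : ℤ, 1 / (k : ℝ) ^ 2 with hZ
  have hZ0 : 0 ≤ Z := tsum_nonneg fun k => by positivity
  refine ⟨B₀ + B₁ * Z, by positivity, fun N k => F ((k : ℝ) / N) / N, fun N hN => ⟨fun k => ?_,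
    fun K hK x => ?_⟩⟩
  · rw [norm_div, Complex.norm_natCast]
    gcongr
    have := h0 ((k : ℝ) / N)
    have : 0 ≤ B₁ * Z := by positivity
    linarith
  have hNpos : (0 : ℝ) < N := by exact_mod_cast hN
  have hKpos : (0 : ℝ) < K := by exact_mod_cast hK
  have hdecay : ∀ k : ℤ, k ≠ 0 → ‖F ((k : ℝ) / N) / N‖ ≤ B₁ * N ^ 19 / |(k : ℝ)| ^ 20 := by
    intro k hk
    have hk' : 0 < |(k : ℝ)| := abs_pos.mpr (by exact_mod_cast hk)
    have := h1 ((k : ℝ) / N)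
    rw [norm_div, Real.norm_eq_abs, Real.norm_eq_abs, abs_of_pos hNpos, div_pow] at this
    rw [norm_div, Complex.norm_natCast, div_le_div_iff₀ hNpos (by positivity)]
    rw [div_mul_eq_mul_div, div_le_iff₀ (by positivity)] at this
    calc _ = |(k : ℝ)| ^ 20 * ‖F ((k : ℝ) / N)‖ := by ring
      _ ≤ _ := this
      _ = _ := by ring
  set t : ℤ → ℂ := fun k => F ((k : ℝ) / N) / N *
    Complex.exp (2 * Real.pi * Complex.I * ↑(k * x)) with ht
  have htn : ∀ k, ‖t k‖ = ‖F ((k : ℝ) / N) / N‖ := by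
    intro k
    rw [ht, norm_mul, norm_cexp_two_pi_mul, mul_one]
  have hsplit : ∀ k : ℤ, 1 / |(k : ℝ)| ^ 20 = 1 / |(k : ℝ)| ^ 18 * (1 / (k : ℝ) ^ 2) := by
    intro k
    rw [← sq_abs (k : ℝ), div_mul_div_comm, one_mul, ← pow_add]
  have htsum : Summable t := by
    refine Summable.of_norm_bounded_eventually (hsum.mul_left (B₁ * N ^ 19)) ?_
    have : ∀ᶠ k : ℤ in cofinite, k ≠ 0 := by
      exact (Set.finite_singleton 0).eventually_cofinite_notMem
    filter_upwards [this] with k hk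
    rw [htn]
    refine (hdecay k hk).trans ?_
    rw [div_eq_mul_one_div, hsplit]
    have : 1 / |(k : ℝ)| ^ 18 ≤ 1 := by
      rw [div_le_one (by have := one_le_abs_cast hk; positivity)]
      exact one_le_pow₀ (one_le_abs_cast hk)
    gcongr
    calc _ ≤ 1 * (1 / (k : ℝ) ^ 2) := by gcongr
      _ = _ := one_mul _
  set s : Finset ℤ := Finset.Icc (-(K : ℤ)) K with hs'
  have h0s : (0 : ℤ) ∈ s := by simp [hs']
  have ht0 : t 0 = ((∫ y, f y : ℝ) : ℂ) / N := by
    have : F 0 = ((∫ y, f y : ℝ) : ℂ) := by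
      rw [hF, Real.fourier_real_eq_integral_exp_smul]
      simp [hg, integral_complex_ofReal]
    simp [ht, this]
  have hdiff : (scaledPeriodization f N x : ℂ) - ((∫ y, f y : ℝ) : ℂ) / N -
      ∑ k ∈ s.erase 0, t k = ∑' k, if k ∈ s then 0 else t k := by
    have hfin : ∑ k ∈ s, t k = ∑' k, if k ∈ s then t k else 0 := by
      rw [tsum_eq_sum (s := s) fun k hk => if_neg hk]
      exact Finset.sum_congr rfl fun k hk => (if_pos hk).symm
    rw [scaledPeriodization_eq_tsum_fourier hf hs hN, sub_sub, ← ht0, Finset.add_sum_erase _ _ h0s,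
      hfin, ← Summable.tsum_sub htsum]
    · refine tsum_congr fun k => ?_
      split_ifs <;> simp
    · exact summable_of_ne_finset_zero (s := s) fun k hk => if_neg hk
  rw [hdiff]
  refine (tsum_of_norm_bounded (hsum.mul_left (B₁ * N ^ 19 / K ^ 18)).hasSum fun k => ?_).trans ?_
  · split_ifs with hk
    · rw [norm_zero]; positivity
    · have hkK : (K : ℝ) ≤ |(k : ℝ)| := by
        rw [hs', Finset.mem_Icc, ← abs_le, not_le] at hk
        exact_mod_cast hk.le
      rw [htn]
      refine (hdecay k (by rintro rfl; exact hk h0s)).trans ?_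
      rw [div_eq_mul_one_div, hsplit, div_eq_mul_one_div _ ((K : ℝ) ^ 18), mul_assoc _ (1 / _)]
      gcongr
  · rw [tsum_mul_left, ← hZ, div_mul_eq_mul_div]
    refine div_le_div_of_nonneg_right ?_ (by positivity)
    have : 0 ≤ B₀ * (N : ℝ) ^ 19 := by positivity
    linarith

lemma sum_ne_eq_sum_pairsLT {E : Type*} [AddCommMonoid E] (N : ℕ) (F : ℕ → ℕ → E) :
    (∑ m ∈ Finset.Icc 1 N, ∑ n ∈ Finset.Icc 1 N, if m ≠ n then F m n else 0) =
      ∑ p ∈ pairsLT N, (F p.1 p.2 + F p.2 p.1) := by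
  rw [pairsLT, Finset.sum_filter, Finset.sum_product]
  have h : ∀ m n : ℕ, (if m < n then F m n + F n m else 0) =
      (if m < n then F m n else 0) + (if m < n then F n m else 0) := by
    intro m n; split_ifs <;> simp
  simp_rw [h, Finset.sum_add_distrib]
  rw [Finset.sum_comm (f := fun m n => if m < n then F n m else 0), ← Finset.sum_add_distrib]
  refine Finset.sum_congr rfl fun m _ => ?_
  rw [← Finset.sum_add_distrib]
  refine Finset.sum_congr rfl fun n _ => ?_
  rcases lt_trichotomy m n with h | h | h
  · simp [h, h.ne, h.not_gt]
  · simp [h]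
  · simp [h, h.ne', h.not_gt]

lemma two_mul_card_pairsLT_add (N : ℕ) : 2 * (pairsLT N).card + N = N ^ 2 := by
  have h := sum_ne_eq_sum_pairsLT N fun _ _ => 1
  simp only [Finset.sum_const, smul_eq_mul] at h
  have h2 : ∀ m ∈ Finset.Icc 1 N, (∑ n ∈ Finset.Icc 1 N, if m ≠ n then 1 else 0) + 1 = N := by
    intro m hm
    have : (∑ n ∈ Finset.Icc 1 N, if m = n then 1 else 0) = 1 := by
      rw [Finset.sum_ite_eq, if_pos hm]
    have h3 : ∀ n ∈ Finset.Icc 1 N, (if m ≠ n then 1 else 0) + (if m = n then 1 else 0) = 1 := by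
      intro n _
      by_cases h : m = n <;> simp [h]
    have h4 := Finset.sum_congr rfl h3
    rw [Finset.sum_add_distrib, this] at h4
    rw [h4]
    simp
  have h4 := Finset.sum_congr rfl h2
  rw [Finset.sum_add_distrib, h] at h4
  simp at h4
  linarith

lemma card_pairsLT_le (N : ℕ) : (pairsLT N).card ≤ N ^ 2 := by
  have := two_mul_card_pairsLT_add N
  omega

lemma card_Icc_neg_erase_zero_le (K : ℕ) : ((Finset.Icc (-(K : ℤ)) K).erase 0).card ≤ 2 * K := by
  rw [Finset.card_erase_of_mem (by simp), Int.card_Icc]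
  omega

lemma card_freqIndex_le (L N K : ℕ) : (freqIndex L N K).card ≤ N ^ 2 * (2 * K) := by
  rw [freqIndex, Finset.card_product]
  exact Nat.mul_le_mul ((Finset.card_filter_le _ _).trans (card_pairsLT_le N))
    (card_Icc_neg_erase_zero_le K)

/-- The contribution to the pair correlation function of the pairs `m < n`. -/
noncomputable def halfR2 (a : ℕ → ℝ) (f : ℝ → ℝ) (N : ℕ) (α : ℝ) : ℝ :=
  (1 / (N : ℝ)) * ∑ p ∈ pairsLT N, scaledPeriodization f N (α * a p.2 - α * a p.1)

lemma R2_eq_halfR2_add (a : ℕ → ℝ) (f : ℝ → ℝ) (N : ℕ) (α : ℝ) :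
    R2 a f N α = halfR2 a f N α + halfR2 a (fun y => f (-y)) N α := by
  rw [R2, sum_ne_eq_sum_pairsLT N fun m n =>
    ∑' j : ℤ, f ((N : ℝ) * (α * a n - α * a m + (j : ℝ))), halfR2, halfR2, ← mul_add,
    ← Finset.sum_add_distrib]
  congr 1
  refine Finset.sum_congr rfl fun p _ => ?_
  simp only [scaledPeriodization]
  congr 1
  rw [← (Equiv.neg ℤ).tsum_eq]
  refine tsum_congr fun j => ?_
  rw [Equiv.neg_apply]
  push_cast
  ring_nf

/-- The oscillating part of the pair correlation function, truncated at `N = j ^ 8`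
to the frequencies `|k| ≤ j ^ 9` and the leading indices `n > j`. -/
noncomputable def oscPart (a : ℕ → ℝ) (c : ℕ → ℤ → ℂ) (j : ℕ) (α : ℝ) : ℂ :=
  ∑ p ∈ freqIndex j (j ^ 8) (j ^ 9), c (j ^ 8) p.2 / (j ^ 8 : ℕ) *
    Complex.exp (2 * Real.pi * Complex.I * ↑(freq a p * α))

lemma norm_halfR2_sub_oscPart_le (a : ℕ → ℝ) {f : ℝ → ℝ} {B : ℝ} {c : ℕ → ℤ → ℂ}
    (hc : ∀ N : ℕ, 1 ≤ N → (∀ k, ‖c N k‖ ≤ B / N) ∧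
      ∀ K : ℕ, 1 ≤ K → ∀ x : ℝ,
        ‖(scaledPeriodization f N x : ℂ) - ((∫ y, f y : ℝ) : ℂ) / N -
          ∑ k ∈ (Finset.Icc (-(K : ℤ)) K).erase 0,
            c N k * Complex.exp (2 * Real.pi * Complex.I * ↑(k * x))‖ ≤
          B * N ^ 19 / K ^ 18) (hB : 0 ≤ B) {j : ℕ} (hj : 1 ≤ j) (α : ℝ) :
    ‖(halfR2 a f (j ^ 8) α : ℂ) -
      (((pairsLT (j ^ 8)).card / ((j : ℝ) ^ 16) * ∫ y, f y : ℝ) : ℂ) - oscPart a c j α‖ ≤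
      3 * B * (1 / j) := by
  have hN : 1 ≤ j ^ 8 := Nat.one_le_pow _ _ hj
  have hK : 1 ≤ j ^ 9 := Nat.one_le_pow _ _ hj
  obtain ⟨hc1, hc2⟩ := hc (j ^ 8) hN
  specialize hc2 (j ^ 9) hK
  have hj0 : (0 : ℝ) < j := by exact_mod_cast hj
  have hj0c : (j : ℂ) ≠ 0 := by exact_mod_cast hj0.ne'
  have hj1 : (1 : ℝ) ≤ j := by exact_mod_cast hj
  set N := j ^ 8 with hNdef
  set K := j ^ 9 with hKdef
  have hNr : (N : ℝ) = (j : ℝ) ^ 8 := by rw [hNdef]; push_cast; rfl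
  have hKr : (K : ℝ) = (j : ℝ) ^ 9 := by rw [hKdef]; push_cast; rfl
  have hNc : (N : ℂ) = (j : ℂ) ^ 8 := by rw [hNdef]; push_cast; rfl
  set A := (Finset.Icc (-(K : ℤ)) K).erase 0 with hA
  set G : ℝ → ℂ := fun x => ∑ k ∈ A, c N k * Complex.exp (2 * Real.pi * Complex.I * ↑(k * x))
    with hG
  set x : ℕ × ℕ → ℝ := fun p => α * a p.2 - α * a p.1 with hx
  have hosc : oscPart a c j α = 1 / (N : ℂ) * ∑ p ∈ (pairsLT N).filter (fun p => j < p.2),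
      G (x p) := by
    rw [oscPart, freqIndex, Finset.sum_product, Finset.mul_sum]
    refine Finset.sum_congr rfl fun p _ => ?_
    rw [hG, Finset.mul_sum]
    refine Finset.sum_congr rfl fun k _ => ?_
    have : freq a (p, k) * α = k * x p := by simp only [freq, hx]; ring
    rw [this]
    ring
  have hGle : ∀ y, ‖G y‖ ≤ 2 * B * j := by
    intro y
    have h1 : ‖G y‖ ≤ ∑ k ∈ A, B / N := by
      refine norm_sum_le_of_le _ fun k _ => ?_
      rw [norm_mul, norm_cexp_two_pi_mul, mul_one]
      exact hc1 k
    rw [Finset.sum_const, nsmul_eq_mul] at h1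
    have h2 : (A.card : ℝ) ≤ 2 * K := by exact_mod_cast card_Icc_neg_erase_zero_le K
    calc ‖G y‖ ≤ A.card * (B / N) := h1
      _ ≤ 2 * K * (B / N) := by gcongr
      _ = 2 * B * j := by rw [hNr, hKr]; field_simp
  have hdecomp : (halfR2 a f N α : ℂ) -
      (((pairsLT N).card / ((j : ℝ) ^ 16) * ∫ y, f y : ℝ) : ℂ) - oscPart a c j α =
      1 / (N : ℂ) * ∑ p ∈ pairsLT N, ((scaledPeriodization f N (x p) : ℂ) -
          ((∫ y, f y : ℝ) : ℂ) / N - G (x p)) +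
        1 / (N : ℂ) * ∑ p ∈ (pairsLT N).filter (fun p => ¬ j < p.2), G (x p) := by
    have hhalf : halfR2 a f N α =
        1 / (N : ℝ) * ∑ p ∈ pairsLT N, scaledPeriodization f N (x p) := rfl
    rw [hosc, hhalf, Finset.sum_sub_distrib, Finset.sum_sub_distrib,
      ← Finset.sum_filter_add_sum_filter_not (pairsLT N) (fun p => j < p.2) fun p => G (x p),
      Finset.sum_const, nsmul_eq_mul]
    push_cast
    rw [hNc]
    field_simp
    ring
  rw [hdecomp]
  refine (norm_add_le _ _).trans ?_
  have hb1 : ‖1 / (N : ℂ) * ∑ p ∈ pairsLT N, ((scaledPeriodization f N (x p) : ℂ) -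
          ((∫ y, f y : ℝ) : ℂ) / N - G (x p))‖ ≤ B * (1 / j) := by
    rw [norm_mul, norm_div, norm_one, Complex.norm_natCast]
    have h1 : ‖∑ p ∈ pairsLT N, ((scaledPeriodization f N (x p) : ℂ) -
          ((∫ y, f y : ℝ) : ℂ) / N - G (x p))‖ ≤ ∑ p ∈ pairsLT N, B * N ^ 19 / K ^ 18 :=
      norm_sum_le_of_le _ fun p _ => hc2 _
    rw [Finset.sum_const, nsmul_eq_mul] at h1
    have h2 : ((pairsLT N).card : ℝ) ≤ (N : ℝ) ^ 2 := by exact_mod_cast card_pairsLT_le N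
    calc _ ≤ 1 / (N : ℝ) * ((N : ℝ) ^ 2 * (B * N ^ 19 / K ^ 18)) := by
            gcongr
            exact h1.trans (by gcongr)
      _ = B * (1 / (j : ℝ) ^ 2) := by rw [hNr, hKr]; field_simp
      _ ≤ B * (1 / j) := by
            gcongr
            exact le_self_pow₀ hj1 two_ne_zero
  have hb2 : ‖1 / (N : ℂ) * ∑ p ∈ (pairsLT N).filter (fun p => ¬ j < p.2), G (x p)‖ ≤
      2 * B * (1 / j) := by
    rw [norm_mul, norm_div, norm_one, Complex.norm_natCast]
    have h1 : ‖∑ p ∈ (pairsLT N).filter (fun p => ¬ j < p.2), G (x p)‖ ≤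
        ∑ p ∈ (pairsLT N).filter (fun p => ¬ j < p.2), 2 * B * j :=
      norm_sum_le_of_le _ fun p _ => hGle _
    rw [Finset.sum_const, nsmul_eq_mul] at h1
    have h2 : (((pairsLT N).filter (fun p => ¬ j < p.2)).card : ℝ) ≤ (j : ℝ) ^ 2 := by
      have hsub : (pairsLT N).filter (fun p => ¬ j < p.2) ⊆ pairsLT j := by
        intro p hp
        rw [Finset.mem_filter, mem_pairsLT] at hp
        rw [mem_pairsLT]
        omega
      exact_mod_cast (Finset.card_le_card hsub).trans (card_pairsLT_le j)
    calc _ ≤ 1 / (N : ℝ) * ((j : ℝ) ^ 2 * (2 * B * j)) := by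
            gcongr
            exact h1.trans (by gcongr)
      _ = 2 * B * (1 / (j : ℝ) ^ 5) := by rw [hNr]; field_simp
      _ ≤ 2 * B * (1 / j) := by
            gcongr
            exact le_self_pow₀ hj1 (by norm_num)
  linarith

lemma eventually_mul_pow_le_mul_pow {C : ℝ} (hC : 1 < C) (s d : ℝ) (hd : 0 < d) (k : ℕ) :
    ∀ᶠ j : ℕ in atTop, s * (j : ℝ) ^ k ≤ d * C ^ j := by
  have h := (tendsto_pow_const_div_const_pow_of_one_lt k hC).const_mul s
  rw [mul_zero] at h
  filter_upwards [h.eventually_le_const hd] with j hj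
  rw [← mul_div_assoc, div_le_iff₀ (by positivity)] at hj
  exact hj

lemma ae_tendsto_oscPart {a : ℕ → ℝ} {C : ℝ} (hC : 1 < C)
    (hpos : ∀ x : ℕ, 1 ≤ x → 0 < a x) (hlac : ∀ x : ℕ, 1 ≤ x → C * a x ≤ a (x + 1))
    {B : ℝ} {c : ℕ → ℤ → ℂ} (hc : ∀ N : ℕ, 1 ≤ N → ∀ k, ‖c N k‖ ≤ B / N) :
    ∀ᵐ α ∂(volume : Measure ℝ), Tendsto (fun j => oscPart a c j α) atTop (nhds 0) := by
  refine ae_tendsto_zero_of_integral_sq_le (fun j => ?_) fun M => ⟨B ^ 2 * (144 * M + 36), ?_⟩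
  · unfold oscPart
    fun_prop
  have hcpos : 0 < 1 - 1 / C := by
    rw [sub_pos, div_lt_one (by linarith)]; exact hC
  filter_upwards [eventually_ge_atTop 1,
    eventually_mul_pow_le_mul_pow hC 16 ((1 - 1 / C) * a 1) (mul_pos hcpos (hpos 1 le_rfl)) 29,
    eventually_mul_pow_le_mul_pow hC 32 (1 - 1 / C) hcpos 18] with j hj h1 h2
  have hj1 : (1 : ℝ) ≤ j := by exact_mod_cast hj
  have hj0 : (0 : ℝ) < j := by linarith
  have hN : 1 ≤ j ^ 8 := Nat.one_le_pow _ _ hj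
  have hK : 1 ≤ j ^ 9 := Nat.one_le_pow _ _ hj
  have hT : (0 : ℝ) < (j : ℝ) ^ 20 := by positivity
  have hcard := card_near_le hC hpos hlac (L := j) (N := j ^ 8) (K := j ^ 9) hK hT
    (by push_cast; linarith) (by push_cast; linarith)
  have hmom := integral_norm_sq_expSum_le (freqIndex j (j ^ 8) (j ^ 9))
    (fun p => c (j ^ 8) p.2 / (j ^ 8 : ℕ)) (freq a) (W := B / (j : ℝ) ^ 16) (M := M)
    (fun p _ => by
      rw [norm_div, Complex.norm_natCast, div_le_iff₀ (by positivity)]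
      refine (hc (j ^ 8) hN p.2).trans_eq ?_
      push_cast
      field_simp) M.cast_nonneg hT
  refine hmom.trans ?_
  have hI : ((freqIndex j (j ^ 8) (j ^ 9)).card : ℝ) ≤ 2 * (j : ℝ) ^ 25 := by
    have : ((freqIndex j (j ^ 8) (j ^ 9)).card : ℝ) ≤ (((j ^ 8) ^ 2 * (2 * j ^ 9) : ℕ) : ℝ) := by
      exact_mod_cast card_freqIndex_le j (j ^ 8) (j ^ 9)
    refine this.trans_eq ?_
    push_cast
    ring
  have hnear : (((freqIndex j (j ^ 8) (j ^ 9) ×ˢ freqIndex j (j ^ 8) (j ^ 9)).filter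
      fun z => |freq a z.1 - freq a z.2| ≤ (j : ℝ) ^ 20).card : ℝ) ≤ 72 * (j : ℝ) ^ 27 := by
    have h3 : 6 * ((j ^ 8) ^ 2 * (j + 1) ^ 2 * (2 * j ^ 9 + 1)) ≤ 72 * j ^ 27 := by
      calc 6 * ((j ^ 8) ^ 2 * (j + 1) ^ 2 * (2 * j ^ 9 + 1)) ≤
          6 * ((j ^ 8) ^ 2 * (j + j) ^ 2 * (2 * j ^ 9 + j ^ 9)) := by gcongr
        _ = 72 * j ^ 27 := by ring
    exact_mod_cast hcard.trans h3
  have h5 : (j : ℝ) ^ 2 ≤ (j : ℝ) ^ 5 := pow_le_pow_right₀ hj1 (by norm_num)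
  calc _ ≤ (B / (j : ℝ) ^ 16) ^ 2 * (2 * M * (72 * (j : ℝ) ^ 27) +
        (2 * (j : ℝ) ^ 25) ^ 2 / (j : ℝ) ^ 20) := by gcongr
    _ = B ^ 2 * (144 * M * (1 / (j : ℝ) ^ 5) + 4 * (1 / (j : ℝ) ^ 2)) := by field_simp; ring
    _ ≤ B ^ 2 * (144 * M * (1 / (j : ℝ) ^ 2) + 36 * (1 / (j : ℝ) ^ 2)) := by
        gcongr
        norm_num
    _ = _ := by ring

lemma tendsto_card_pairsLT_div :
    Tendsto (fun j : ℕ => ((pairsLT (j ^ 8)).card : ℝ) / (j : ℝ) ^ 16) atTop (nhds (1 / 2)) := by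
  have h : Tendsto (fun j : ℕ => (1 - (1 / (j : ℝ)) ^ 8) / 2) atTop (nhds ((1 - 0 ^ 8) / 2)) :=
    ((tendsto_one_div_atTop_nhds_zero_nat.pow 8).const_sub 1).div_const 2
  rw [show ((1 : ℝ) - 0 ^ 8) / 2 = 1 / 2 by norm_num] at h
  refine h.congr' ?_
  filter_upwards [eventually_ge_atTop 1] with j hj
  have hj0 : (j : ℝ) ≠ 0 := by positivity
  have hcard : 2 * ((pairsLT (j ^ 8)).card : ℝ) + (j : ℝ) ^ 8 = ((j : ℝ) ^ 8) ^ 2 := by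
    exact_mod_cast two_mul_card_pairsLT_add (j ^ 8)
  have : ((pairsLT (j ^ 8)).card : ℝ) = ((j : ℝ) ^ 16 - (j : ℝ) ^ 8) / 2 := by
    linear_combination hcard / 2
  rw [this]
  field_simp

lemma ae_tendsto_halfR2 {a : ℕ → ℝ} {C : ℝ} (hC : 1 < C)
    (hpos : ∀ x : ℕ, 1 ≤ x → 0 < a x) (hlac : ∀ x : ℕ, 1 ≤ x → C * a x ≤ a (x + 1))
    {f : ℝ → ℝ} (hf : ContDiff ℝ (⊤ : ℕ∞) f) (hs : HasCompactSupport f) :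
    ∀ᵐ α ∂(volume : Measure ℝ),
      Tendsto (fun j : ℕ => halfR2 a f (j ^ 8) α) atTop (nhds (1 / 2 * ∫ y, f y)) := by
  obtain ⟨B, hB, c, hc⟩ := exists_trigPoly_approx hf hs
  filter_upwards [ae_tendsto_oscPart hC hpos hlac fun N hN => (hc N hN).1] with α hα
  have herr : Tendsto (fun j : ℕ => (halfR2 a f (j ^ 8) α : ℂ) -
      (((pairsLT (j ^ 8)).card / ((j : ℝ) ^ 16) * ∫ y, f y : ℝ) : ℂ) - oscPart a c j α)
      atTop (nhds 0) := by
    have hz : Tendsto (fun j : ℕ => 3 * B * (1 / (j : ℝ))) atTop (nhds 0) := by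
      simpa using tendsto_one_div_atTop_nhds_zero_nat.const_mul (3 * B)
    refine squeeze_zero_norm' ?_ hz
    filter_upwards [eventually_ge_atTop 1] with j hj
    exact norm_halfR2_sub_oscPart_le a hc hB hj α
  have hmain : Tendsto (fun j : ℕ =>
      (((pairsLT (j ^ 8)).card / ((j : ℝ) ^ 16) * ∫ y, f y : ℝ) : ℂ)) atTop
      (nhds ((1 / 2 * ∫ y, f y : ℝ) : ℂ)) :=
    (Complex.continuous_ofReal.tendsto _).comp (tendsto_card_pairsLT_div.mul_const _)
  have htot := (herr.add hα).add hmain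
  simp only [sub_add_cancel, zero_add] at htot
  have := (Complex.continuous_re.tendsto _).comp htot
  simpa only [Function.comp_def, Complex.ofReal_re] using this

lemma ae_tendsto_R2_pow_eight {a : ℕ → ℝ} {C : ℝ} (hC : 1 < C)
    (hpos : ∀ x : ℕ, 1 ≤ x → 0 < a x) (hlac : ∀ x : ℕ, 1 ≤ x → C * a x ≤ a (x + 1))
    {f : ℝ → ℝ} (hf : ContDiff ℝ (⊤ : ℕ∞) f) (hs : HasCompactSupport f) :
    ∀ᵐ α ∂(volume : Measure ℝ),
      Tendsto (fun j : ℕ => R2 a f (j ^ 8) α) atTop (nhds (∫ y, f y)) := by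
  have hs' : HasCompactSupport fun y => f (-y) := hs.comp_homeomorph (Homeomorph.neg ℝ)
  filter_upwards [ae_tendsto_halfR2 hC hpos hlac hf hs,
    ae_tendsto_halfR2 hC hpos hlac (hf.comp contDiff_neg) hs'] with α h1 h2
  have h := h1.add h2
  have e : ∫ y, (f ∘ fun y => -y) y = ∫ y, f y := integral_neg_eq_self f volume
  rw [e, ← add_mul] at h
  norm_num at h
  refine h.congr fun j => (R2_eq_halfR2_add a f (j ^ 8) α).symm

lemma summable_int_of_hasCompactSupport {f : ℝ → ℝ} (hf : HasCompactSupport f) {t : ℝ}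
    (ht : t ≠ 0) (x : ℝ) : Summable fun j : ℤ => f (t * (x + j)) := by
  refine summable_of_hasFiniteSupport ?_
  have h1 : HasCompactSupport fun y : ℝ => f (t * (x + y)) :=
    (hf.comp_smul ht).comp_homeomorph (Homeomorph.addLeft x)
  have h2 : (((↑) : ℤ → ℝ) ⁻¹' tsupport fun y : ℝ => f (t * (x + y))).Finite :=
    (Int.isClosedEmbedding_coe_real.isCompact_preimage h1.isCompact).finite_of_discrete
  exact h2.subset fun j hj => subset_tsupport _ hj


lemma tsum_int_le_tsum_int {f g : ℝ → ℝ} (hf : HasCompactSupport f) (hg : HasCompactSupport g)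
    {s t x : ℝ} (hs : s ≠ 0) (ht : t ≠ 0) (h : ∀ y, f (s * y) ≤ g (t * y)) :
    ∑' j : ℤ, f (s * (x + j)) ≤ ∑' j : ℤ, g (t * (x + j)) :=
  (summable_int_of_hasCompactSupport hf hs x).tsum_le_tsum (fun _ => h _)
    (summable_int_of_hasCompactSupport hg ht x)

lemma R2_add_const_mul (a : ℕ → ℝ) {f g : ℝ → ℝ} (hf : HasCompactSupport f)
    (hg : HasCompactSupport g) (c : ℝ) (N : ℕ) (α : ℝ) :
    R2 a (fun y => f y + c * g y) N α = R2 a f N α + c * R2 a g N α := by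
  rcases Nat.eq_zero_or_pos N with rfl | hN
  · simp [R2]
  have hN0 : (N : ℝ) ≠ 0 := by positivity
  simp only [R2]
  rw [mul_left_comm, ← mul_add, Finset.mul_sum (a := c), ← Finset.sum_add_distrib]
  congr 1
  refine Finset.sum_congr rfl fun m _ => ?_
  rw [Finset.mul_sum, ← Finset.sum_add_distrib]
  refine Finset.sum_congr rfl fun n _ => ?_
  split_ifs
  · rw [← tsum_mul_left]
    exact (summable_int_of_hasCompactSupport hf hN0 _).tsum_add
      ((summable_int_of_hasCompactSupport hg hN0 _).mul_left c)
  · simp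

lemma R2_mono (a : ℕ → ℝ) {f g : ℝ → ℝ} (hf : HasCompactSupport f)
    (hg : HasCompactSupport g) (h : ∀ y, f y ≤ g y) (N : ℕ) (α : ℝ) :
    R2 a f N α ≤ R2 a g N α := by
  rcases Nat.eq_zero_or_pos N with rfl | hN
  · simp [R2]
  have hN0 : (N : ℝ) ≠ 0 := by positivity
  simp only [R2]
  gcongr with m _ n _
  split_ifs
  · exact tsum_int_le_tsum_int hf hg hN0 hN0 fun _ => h _
  · rfl

lemma mul_R2_le_mul_R2 (a : ℕ → ℝ) {f g : ℝ → ℝ} (hf : HasCompactSupport f)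
    (hg : HasCompactSupport g) (hg0 : ∀ y, 0 ≤ g y) {N M : ℕ} (hN : 1 ≤ N) (hNM : N ≤ M)
    (h : ∀ y : ℝ, f (N * y) ≤ g (M * y)) (α : ℝ) :
    N * R2 a f N α ≤ M * R2 a g M α := by
  have hN0 : (N : ℝ) ≠ 0 := by positivity
  have hM0 : (M : ℝ) ≠ 0 := Nat.cast_ne_zero.2 (by omega)
  have hsub : Finset.Icc 1 N ⊆ Finset.Icc 1 M := Finset.Icc_subset_Icc_right hNM
  have hterm : ∀ m n : ℕ, 0 ≤ if m ≠ n then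
      ∑' j : ℤ, g ((M : ℝ) * (α * a n - α * a m + (j : ℝ))) else 0 := by
    intro m n
    split_ifs
    · exact tsum_nonneg fun _ => hg0 _
    · rfl
  rw [R2, R2, ← mul_assoc, ← mul_assoc, mul_one_div_cancel hN0, mul_one_div_cancel hM0, one_mul,
    one_mul]
  refine le_trans ?_ (Finset.sum_le_sum_of_subset_of_nonneg hsub fun m _ _ =>
    Finset.sum_nonneg fun n _ => hterm m n)
  refine Finset.sum_le_sum fun m _ => ?_
  refine le_trans ?_ (Finset.sum_le_sum_of_subset_of_nonneg hsub fun n _ _ => hterm m n)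
  refine Finset.sum_le_sum fun n _ => ?_
  split_ifs
  · exact tsum_int_le_tsum_int hf hg hN0 hM0 h
  · rfl

lemma tendsto_of_forall_squeeze {ι : Type*} {l : Filter ι} {u : ι → ℝ} {I K : ℝ}
    (hupper : ∀ η > 0, ∃ (U : ι → ℝ) (I' : ℝ), Tendsto U l (nhds I') ∧ I' ≤ I + η * K ∧
      ∀ᶠ i in l, u i ≤ U i)
    (hlower : ∀ η > 0, ∃ (U : ι → ℝ) (I' : ℝ), Tendsto U l (nhds I') ∧ I - η * K ≤ I' ∧
      ∀ᶠ i in l, U i ≤ u i) :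
    Tendsto u l (nhds I) := by
  have hK : Tendsto (fun η : ℝ => η * K) (nhdsWithin 0 (Set.Ioi 0)) (nhds 0) := by
    have : Tendsto (fun η : ℝ => η * K) (nhds 0) (nhds (0 * K)) :=
      (continuous_id.mul continuous_const).tendsto 0
    rw [zero_mul] at this
    exact this.mono_left nhdsWithin_le_nhds
  refine tendsto_order.2 ⟨fun b hb => ?_, fun b hb => ?_⟩
  · obtain ⟨η, hη, hη0⟩ := ((hK.eventually_lt_const (sub_pos.2 hb)).and
      self_mem_nhdsWithin).exists
    obtain ⟨U, I', hU, hI, hle⟩ := hlower η hη0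
    filter_upwards [hle, hU.eventually_const_lt (show b < I' by linarith)] with i h1 h2
    exact h2.trans_le h1
  · obtain ⟨η, hη, hη0⟩ := ((hK.eventually_lt_const (sub_pos.2 hb)).and
      self_mem_nhdsWithin).exists
    obtain ⟨U, I', hU, hI, hle⟩ := hupper η hη0
    filter_upwards [hle, hU.eventually_lt_const (show I' < b by linarith)] with i h1 h2
    exact h1.trans_lt h2

lemma exists_smooth_bump (R : ℝ) : ∃ χ : ℝ → ℝ, ContDiff ℝ (⊤ : ℕ∞) χ ∧ HasCompactSupport χ ∧
    (∀ x, 0 ≤ χ x) ∧ ∀ x, |x| ≤ R → χ x = 1 := by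
  let b : ContDiffBump (0 : ℝ) := ⟨|R| + 1, |R| + 2, by positivity, by linarith⟩
  refine ⟨b, b.contDiff, b.hasCompactSupport, fun x => b.nonneg, fun x hx =>
    b.one_of_mem_closedBall ?_⟩
  rw [Metric.mem_closedBall, Real.dist_0_eq_abs]
  exact hx.trans ((le_abs_self R).trans (by linarith : |R| ≤ |R| + 1))

lemma exists_abs_le_of_hasCompactSupport {f : ℝ → ℝ} (hs : HasCompactSupport f) :
    ∃ R : ℕ, ∀ x, (R : ℝ) < |x| → f x = 0 := by
  obtain ⟨r, hr⟩ := hs.isCompact.isBounded.subset_closedBall 0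
  obtain ⟨R, hR⟩ := exists_nat_ge r
  refine ⟨R, fun x hx => image_eq_zero_of_notMem_tsupport fun h => ?_⟩
  have := hr h
  rw [Metric.mem_closedBall, Real.dist_0_eq_abs] at this
  linarith

lemma exists_countable_forall_dist_lt {X Y : Type*} [PseudoMetricSpace Y]
    [SecondCountableTopology Y] (φ : X → Y) :
    ∃ s : Set X, s.Countable ∧ ∀ x, ∀ ε > 0, ∃ y ∈ s, dist (φ x) (φ y) < ε := by
  let _ : PseudoMetricSpace X := PseudoMetricSpace.induced φ inferInstance
  have hφ : Topology.IsInducing φ := ⟨rfl⟩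
  have := hφ.secondCountableTopology
  obtain ⟨s, hsc, hsd⟩ := TopologicalSpace.exists_countable_dense X
  exact ⟨s, hsc, fun x ε hε => hsd.exists_dist_lt x hε⟩

/-- The smooth functions vanishing outside `[-R, R]` are separable for the uniform distance. -/
lemma exists_countable_uniformly_dense (R : ℕ) : ∃ S : Set (ℝ → ℝ), S.Countable ∧
    (∀ g ∈ S, ContDiff ℝ (⊤ : ℕ∞) g ∧ ∀ x, (R : ℝ) < |x| → g x = 0) ∧
    ∀ f : ℝ → ℝ, ContDiff ℝ (⊤ : ℕ∞) f → (∀ x, (R : ℝ) < |x| → f x = 0) → ∀ η > 0,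
      ∃ g ∈ S, ∀ x : ℝ, |x| ≤ R → |f x - g x| ≤ η := by
  let X := {g : ℝ → ℝ // ContDiff ℝ (⊤ : ℕ∞) g ∧ ∀ x, (R : ℝ) < |x| → g x = 0}
  let φ : X → C(Set.Icc (-(R : ℝ)) R, ℝ) := fun g => ⟨fun x => g.1 x,
    g.2.1.continuous.comp continuous_subtype_val⟩
  obtain ⟨s, hsc, hsd⟩ := exists_countable_forall_dist_lt φ
  refine ⟨Subtype.val '' s, hsc.image _, ?_, fun f hf hf0 η hη => ?_⟩
  · rintro _ ⟨g, _, rfl⟩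
    exact g.2
  · obtain ⟨g, hg, hdist⟩ := hsd ⟨f, hf, hf0⟩ η hη
    refine ⟨g, ⟨g, hg, rfl⟩, fun x hx => ?_⟩
    exact (ContinuousMap.dist_apply_le_dist (f := φ ⟨f, hf, hf0⟩) (g := φ g)
      ⟨x, abs_le.1 hx⟩).trans hdist.le

lemma exists_countable_dense_testFunctions : ∃ S : Set (ℝ → ℝ), S.Countable ∧
    (∀ g ∈ S, ContDiff ℝ (⊤ : ℕ∞) g ∧ HasCompactSupport g) ∧
    ∀ f : ℝ → ℝ, ContDiff ℝ (⊤ : ℕ∞) f → HasCompactSupport f →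
      ∃ χ ∈ S, ∀ η > 0, ∃ g ∈ S, ∀ x, |f x - g x| ≤ η * χ x := by
  choose χ hχ1 hχ2 hχ3 hχ4 using fun R : ℕ => exists_smooth_bump R
  choose S hS1 hS2 hS3 using exists_countable_uniformly_dense
  refine ⟨⋃ R, insert (χ R) (S R), Set.countable_iUnion fun R => (hS1 R).insert _, ?_, ?_⟩
  · intro g hg
    obtain ⟨R, hR⟩ := Set.mem_iUnion.1 hg
    rcases hR with rfl | hR
    · exact ⟨hχ1 R, hχ2 R⟩
    · refine ⟨(hS2 R g hR).1, HasCompactSupport.of_support_subset_isCompact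
        (isCompact_Icc (a := -(R : ℝ)) (b := R)) fun x hx => ?_⟩
      rw [Set.mem_Icc, ← abs_le]
      by_contra! h
      exact hx ((hS2 R g hR).2 x h)
  · intro f hf hs
    obtain ⟨R, hR⟩ := exists_abs_le_of_hasCompactSupport hs
    refine ⟨χ R, Set.mem_iUnion.2 ⟨R, Set.mem_insert _ _⟩, fun η hη => ?_⟩
    obtain ⟨g, hg, hfg⟩ := hS3 R f hf hR η hη
    refine ⟨g, Set.mem_iUnion.2 ⟨R, Set.mem_insert_of_mem _ hg⟩, fun x => ?_⟩
    rcases le_or_gt |x| R with h | h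
    · rw [hχ4 R x h, mul_one]
      exact hfg x h
    · rw [hR x h, (hS2 R g hg).2 x h, sub_zero, abs_zero]
      exact mul_nonneg hη.le (hχ3 R x)

lemma integral_add_const_mul {f g : ℝ → ℝ} (hf : ContDiff ℝ (⊤ : ℕ∞) f)
    (hfs : HasCompactSupport f) (hg : ContDiff ℝ (⊤ : ℕ∞) g) (hgs : HasCompactSupport g) (c : ℝ) :
    ∫ x, (f x + c * g x) = (∫ x, f x) + c * ∫ x, g x := by
  rw [integral_add (hf.continuous.integrable_of_hasCompactSupport hfs)
    ((hg.continuous.integrable_of_hasCompactSupport hgs).const_mul c), integral_const_mul]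

/-- Convergence of the pair correlation along a sequence passes from a uniformly dense family of
test functions to all test functions. -/
lemma tendsto_R2_of_dense (a : ℕ → ℝ) (α : ℝ) {ν : ℕ → ℕ} {S : Set (ℝ → ℝ)}
    (hS : ∀ g ∈ S, ContDiff ℝ (⊤ : ℕ∞) g ∧ HasCompactSupport g)
    (hlim : ∀ g ∈ S, Tendsto (fun j => R2 a g (ν j) α) atTop (nhds (∫ x, g x)))
    {f χ : ℝ → ℝ} (hf : ContDiff ℝ (⊤ : ℕ∞) f) (hfs : HasCompactSupport f) (hχ : χ ∈ S)
    (happrox : ∀ η > 0, ∃ g ∈ S, ∀ x, |f x - g x| ≤ η * χ x) :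
    Tendsto (fun j => R2 a f (ν j) α) atTop (nhds (∫ x, f x)) := by
  obtain ⟨hχ1, hχ2⟩ := hS χ hχ
  have hcs : ∀ {u v : ℝ → ℝ} (c : ℝ), HasCompactSupport u → HasCompactSupport v →
      HasCompactSupport fun x => u x + c * v x :=
    fun c hu hv => hu.add (hv.mul_left (f := fun _ => c))
  have hint : ∀ {u v : ℝ → ℝ}, ContDiff ℝ (⊤ : ℕ∞) u → HasCompactSupport u →
      ContDiff ℝ (⊤ : ℕ∞) v → HasCompactSupport v → (∀ x, u x ≤ v x) →
      ∫ x, u x ≤ ∫ x, v x := fun h1 h2 h3 h4 h =>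
    integral_mono (h1.continuous.integrable_of_hasCompactSupport h2)
      (h3.continuous.integrable_of_hasCompactSupport h4) h
  refine tendsto_of_forall_squeeze (K := 2 * ∫ x, χ x) (fun η hη => ?_) fun η hη => ?_
  all_goals
    obtain ⟨g, hg, hfg⟩ := happrox η hη
    obtain ⟨hg1, hg2⟩ := hS g hg
  · refine ⟨fun j => R2 a g (ν j) α + η * R2 a χ (ν j) α, (∫ x, g x) + η * ∫ x, χ x,
      (hlim g hg).add ((hlim χ hχ).const_mul η), ?_, Eventually.of_forall fun j => ?_⟩
    · have := hint hg1 hg2 (hf.add (contDiff_const.mul hχ1)) (hcs η hfs hχ2) fun x => by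
        linarith [(abs_le.1 (hfg x)).1]
      rw [integral_add_const_mul hf hfs hχ1 hχ2] at this
      linarith
    · beta_reduce
      rw [← R2_add_const_mul a hg2 hχ2]
      exact R2_mono a hfs (hcs η hg2 hχ2) (fun x => by linarith [(abs_le.1 (hfg x)).2]) _ _
  · refine ⟨fun j => R2 a g (ν j) α + -η * R2 a χ (ν j) α, (∫ x, g x) + -η * ∫ x, χ x,
      (hlim g hg).add ((hlim χ hχ).const_mul _), ?_, Eventually.of_forall fun j => ?_⟩
    · have := hint (hf.add (contDiff_const.mul hχ1)) (hcs (-η) hfs hχ2) hg1 hg2 fun x => by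
        linarith [(abs_le.1 (hfg x)).2]
      rw [integral_add_const_mul hf hfs hχ1 hχ2] at this
      linarith
    · beta_reduce
      rw [← R2_add_const_mul a hg2 hχ2]
      exact R2_mono a (hcs (-η) hg2 hχ2) hfs (fun x => by linarith [(abs_le.1 (hfg x)).1]) _ _

lemma exists_dilation_le {f : ℝ → ℝ} (hf : Continuous f) (hs : HasCompactSupport f) :
    ∃ χ : ℝ → ℝ, ContDiff ℝ (⊤ : ℕ∞) χ ∧ HasCompactSupport χ ∧ (∀ x, 0 ≤ χ x) ∧
      ∀ η > 0, ∃ δ > 0, ∀ t : ℝ, |t - 1| < δ → ∀ y, |f (t * y) - f y| ≤ η * χ y := by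
  obtain ⟨R, hR⟩ := exists_abs_le_of_hasCompactSupport hs
  obtain ⟨χ, hχ1, hχ2, hχ3, hχ4⟩ := exists_smooth_bump (2 * R)
  refine ⟨χ, hχ1, hχ2, hχ3, fun η hη => ?_⟩
  obtain ⟨δ, hδ, hunif⟩ := Metric.uniformContinuous_iff.1
    (hs.uniformContinuous_of_continuous hf) η hη
  refine ⟨min (1 / 2) (δ / (2 * R + 1)), by positivity, fun t ht y => ?_⟩
  obtain ⟨ht1, ht2⟩ := lt_min_iff.1 ht
  rcases le_or_gt |y| (2 * R) with h | h
  · rw [hχ4 y h, mul_one, ← Real.dist_eq]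
    refine (hunif ?_).le
    rw [Real.dist_eq, show t * y - y = (t - 1) * y by ring, abs_mul]
    rw [lt_div_iff₀ (by positivity)] at ht2
    have : |t - 1| * |y| ≤ |t - 1| * (2 * R + 1) := by gcongr; linarith
    linarith
  · have hR0 : (0 : ℝ) ≤ R := R.cast_nonneg
    have h1 : f y = 0 := hR y (by linarith)
    have h2 : f (t * y) = 0 := by
      refine hR _ ?_
      have : 1 / 2 ≤ |t| := (by linarith [(abs_lt.1 ht1).1] : 1 / 2 ≤ t).trans (le_abs_self t)
      rw [abs_mul]
      nlinarith [abs_nonneg y]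
    rw [h1, h2, sub_zero, abs_zero]
    exact mul_nonneg hη.le (hχ3 y)

lemma tendsto_R2_of_nonneg {a : ℕ → ℝ} {α : ℝ}
    (hlim : ∀ g : ℝ → ℝ, ContDiff ℝ (⊤ : ℕ∞) g → HasCompactSupport g →
      Tendsto (fun j : ℕ => R2 a g (j ^ 8) α) atTop (nhds (∫ x, g x)))
    {f : ℝ → ℝ} (hf : ContDiff ℝ (⊤ : ℕ∞) f) (hfs : HasCompactSupport f) (hf0 : ∀ x, 0 ≤ f x) :
    Tendsto (fun N : ℕ => R2 a f N α) atTop (nhds (∫ x, f x)) := by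
  obtain ⟨χ, hχ1, hχ2, hχ0, hχ⟩ := exists_dilation_le hf.continuous hfs
  set r : ℕ → ℕ := fun N => N.sqrt.sqrt.sqrt with hr
  have hrle : ∀ N, r N ^ 8 ≤ N := fun N => by
    calc r N ^ 8 = ((r N ^ 2) ^ 2) ^ 2 := by ring
      _ ≤ (N.sqrt.sqrt ^ 2) ^ 2 := by gcongr; exact Nat.sqrt_le' _
      _ ≤ N.sqrt ^ 2 := by gcongr; exact Nat.sqrt_le' _
      _ ≤ N := Nat.sqrt_le' _
  have hlt : ∀ N, N ≤ (r N + 1) ^ 8 := fun N => by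
    have h1 : N.sqrt < (N.sqrt.sqrt + 1) ^ 2 := Nat.lt_succ_sqrt' _
    have h2 : N.sqrt.sqrt < (r N + 1) ^ 2 := Nat.lt_succ_sqrt' _
    calc N ≤ (N.sqrt + 1) ^ 2 := (Nat.lt_succ_sqrt' N).le
      _ ≤ ((N.sqrt.sqrt + 1) ^ 2) ^ 2 := by gcongr; exact h1
      _ ≤ (((r N + 1) ^ 2) ^ 2) ^ 2 := by gcongr; exact h2
      _ = (r N + 1) ^ 8 := by ring
  have hrtop : Tendsto r atTop atTop := by
    refine tendsto_atTop.2 fun b => ?_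
    filter_upwards [eventually_ge_atTop (((b ^ 2) ^ 2) ^ 2)] with N hN
    exact Nat.le_sqrt'.2 (Nat.le_sqrt'.2 (Nat.le_sqrt'.2 hN))
  have hr1top : Tendsto (fun N => r N + 1) atTop atTop := (tendsto_add_atTop_nat 1).comp hrtop
  have hratio : Tendsto (fun N : ℕ => ((r N : ℝ) / ((r N : ℝ) + 1)) ^ 8) atTop (nhds 1) := by
    have := (tendsto_natCast_div_add_atTop (1 : ℝ)).comp hrtop |>.pow 8
    simpa [Function.comp_def] using this
  have hge : ∀ᶠ N in atTop, 1 ≤ r N := hrtop.eventually_ge_atTop 1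
  have hlo : Tendsto (fun N : ℕ => ((r N ^ 8 : ℕ) : ℝ) / N) atTop (nhds 1) := by
    refine tendsto_of_tendsto_of_tendsto_of_le_of_le' hratio tendsto_const_nhds ?_ ?_
    · filter_upwards [hge] with N hN
      have hNpos : 0 < N := lt_of_lt_of_le (by positivity) (hrle N)
      have : (N : ℝ) ≤ ((r N : ℝ) + 1) ^ 8 := by exact_mod_cast hlt N
      rw [div_pow]
      push_cast
      gcongr
    · exact Eventually.of_forall fun N =>
        div_le_one_of_le₀ (by exact_mod_cast hrle N) N.cast_nonneg
  have hhi : Tendsto (fun N : ℕ => (((r N + 1) ^ 8 : ℕ) : ℝ) / N) atTop (nhds 1) := by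
    have := hlo.div hratio one_ne_zero
    rw [div_one] at this
    refine this.congr' ?_
    filter_upwards [hge] with N hN
    have hNpos : 0 < N := lt_of_lt_of_le (by positivity) (hrle N)
    simp only [Pi.div_apply]
    push_cast
    field_simp
  refine tendsto_of_forall_squeeze (K := ∫ x, χ x) (fun η hη => ?_) fun η hη => ?_
  all_goals obtain ⟨δ, hδ, hdil⟩ := hχ η hη
  · have hcd : ContDiff ℝ (⊤ : ℕ∞) fun x => f x + η * χ x := hf.add (contDiff_const.mul hχ1)
    have hcs : HasCompactSupport fun x => f x + η * χ x :=
      hfs.add (hχ2.mul_left (f := fun _ => η))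
    refine ⟨_, _, hhi.mul ((hlim _ hcd hcs).comp hr1top), ?_, ?_⟩
    · rw [one_mul, integral_add_const_mul hf hfs hχ1 hχ2]
    · have hinv : Tendsto (fun N : ℕ => (N : ℝ) / ((r N + 1) ^ 8 : ℕ)) atTop (nhds 1) := by
        simpa using hhi.inv₀ one_ne_zero
      filter_upwards [hge, Metric.tendsto_nhds.1 hinv δ hδ] with N hN hclose
      have hNpos : 0 < N := lt_of_lt_of_le (by positivity) (hrle N)
      have hM0 : (((r N + 1) ^ 8 : ℕ) : ℝ) ≠ 0 := by positivity
      have := mul_R2_le_mul_R2 a hfs hcs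
        (fun y => add_nonneg (hf0 y) (mul_nonneg hη.le (hχ0 y))) hNpos (hlt N) (fun y => by
          have h := (abs_le.1 (hdil _ hclose (((r N + 1) ^ 8 : ℕ) * y))).2
          rw [← mul_assoc, div_mul_cancel₀ _ hM0] at h
          linarith) α
      rw [Function.comp_apply, div_mul_eq_mul_div, le_div_iff₀ (by positivity), mul_comm]
      exact this
  · have hcd : ContDiff ℝ (⊤ : ℕ∞) fun x => f x + -η * χ x := hf.add (contDiff_const.mul hχ1)
    have hcs : HasCompactSupport fun x => f x + -η * χ x :=
      hfs.add (hχ2.mul_left (f := fun _ => -η))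
    refine ⟨_, _, hlo.mul ((hlim _ hcd hcs).comp hrtop), ?_, ?_⟩
    · rw [one_mul, integral_add_const_mul hf hfs hχ1 hχ2]
      linarith
    · have hinv : Tendsto (fun N : ℕ => (N : ℝ) / (r N ^ 8 : ℕ)) atTop (nhds 1) := by
        simpa using hlo.inv₀ one_ne_zero
      filter_upwards [hge, Metric.tendsto_nhds.1 hinv δ hδ] with N hN hclose
      have hP : 1 ≤ r N ^ 8 := Nat.one_le_pow _ _ hN
      have hNpos : 0 < N := lt_of_lt_of_le hP (hrle N)
      have hP0 : ((r N ^ 8 : ℕ) : ℝ) ≠ 0 := by positivity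
      have := mul_R2_le_mul_R2 a hcs hfs hf0 hP (hrle N) (fun y => by
          have h := (abs_le.1 (hdil _ hclose ((r N ^ 8 : ℕ) * y))).1
          rw [← mul_assoc, div_mul_cancel₀ _ hP0] at h
          linarith) α
      rw [Function.comp_apply, div_mul_eq_mul_div, div_le_iff₀ (by positivity),
        mul_comm (R2 a f N α)]
      exact this

lemma exists_add_const_mul_nonneg {f : ℝ → ℝ} (hf : Continuous f) (hs : HasCompactSupport f) :
    ∃ χ : ℝ → ℝ, ContDiff ℝ (⊤ : ℕ∞) χ ∧ HasCompactSupport χ ∧ (∀ x, 0 ≤ χ x) ∧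
      ∃ c : ℝ, ∀ x, 0 ≤ f x + c * χ x := by
  obtain ⟨R, hR⟩ := exists_abs_le_of_hasCompactSupport hs
  obtain ⟨χ, hχ1, hχ2, hχ3, hχ4⟩ := exists_smooth_bump R
  obtain ⟨c, hc⟩ := hf.bounded_above_of_compact_support hs
  refine ⟨χ, hχ1, hχ2, hχ3, c, fun x => ?_⟩
  rcases le_or_gt |x| R with h | h
  · rw [hχ4 x h, mul_one]
    linarith [neg_abs_le (f x), hc x, Real.norm_eq_abs (f x)]
  · rw [hR x h, zero_add]
    exact mul_nonneg ((norm_nonneg _).trans (hc x)) (hχ3 x)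

lemma tendsto_R2_of_tendsto_pow_eight {a : ℕ → ℝ} {α : ℝ}
    (hlim : ∀ g : ℝ → ℝ, ContDiff ℝ (⊤ : ℕ∞) g → HasCompactSupport g →
      Tendsto (fun j : ℕ => R2 a g (j ^ 8) α) atTop (nhds (∫ x, g x)))
    {f : ℝ → ℝ} (hf : ContDiff ℝ (⊤ : ℕ∞) f) (hfs : HasCompactSupport f) :
    Tendsto (fun N : ℕ => R2 a f N α) atTop (nhds (∫ x, f x)) := by
  obtain ⟨χ, hχ1, hχ2, hχ0, c, hc⟩ := exists_add_const_mul_nonneg hf.continuous hfs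
  have hcd : ContDiff ℝ (⊤ : ℕ∞) fun x => f x + c * χ x := hf.add (contDiff_const.mul hχ1)
  have hcs : HasCompactSupport fun x => f x + c * χ x :=
    hfs.add (hχ2.mul_left (f := fun _ => c))
  have h := (tendsto_R2_of_nonneg hlim hcd hcs hc).sub
    ((tendsto_R2_of_nonneg hlim hχ1 hχ2 hχ0).const_mul c)
  refine Tendsto.congr (fun N => ?_) (h.trans_eq ?_)
  · rw [R2_add_const_mul a hfs hχ2]
    ring
  · rw [integral_add_const_mul hf hfs hχ1 hχ2]
    ring_nf

/-- If `a` is a lacunary sequence of positive reals, then for Lebesgue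
almost every `α`, for every smooth compactly supported `f`, the smoothed pair correlation
function converges to the Poisson limit `∫ f`. -/
theorem smoothed_pair_correlation_poissonian_of_lacunary
    (a : ℕ → ℝ) (C : ℝ) (hC : 1 < C)
    (hpos : ∀ x : ℕ, 1 ≤ x → 0 < a x)
    (hlac : ∀ x : ℕ, 1 ≤ x → C * a x ≤ a (x + 1)) :
    ∀ᵐ α ∂(volume : Measure ℝ), ∀ f : ℝ → ℝ,
      ContDiff ℝ (⊤ : ℕ∞) f → HasCompactSupport f →
      Tendsto (fun N : ℕ => R2 a f N α) atTop (nhds (∫ x : ℝ, f x)) := by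
  obtain ⟨S, hScount, hS, hdense⟩ := exists_countable_dense_testFunctions
  have hae : ∀ᵐ α ∂(volume : Measure ℝ), ∀ g ∈ S,
      Tendsto (fun j : ℕ => R2 a g (j ^ 8) α) atTop (nhds (∫ x, g x)) :=
    (ae_ball_iff hScount).2 fun g hg => ae_tendsto_R2_pow_eight hC hpos hlac (hS g hg).1 (hS g hg).2
  filter_upwards [hae] with α hα f hf hfs
  refine tendsto_R2_of_tendsto_pow_eight (fun g hg hgs => ?_) hf hfs
  obtain ⟨χ, hχ, happrox⟩ := hdense g hg hgs
  exact tendsto_R2_of_dense a α hS hα hg hgs hχ happrox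
end
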